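/- arXiv:2308.11238 — 2 statements merged into one kernel-verified Lean document; each statement's English description precedes it below -/
import Mathlib

section
/- Decomposition of distorted expectations for ISS distortions: Let h be an inverse S-shaped distortion function with inflection point p∈(0,1) such that the right derivatives satisfy h'(p⁺) ≥ h'(0⁺). Then there exist θ, θ₁, θ₂ ≥ 0 and convex distortion functions h₁, h₂ such that for every bounded random variable Z, E^h[Z] = θ·E[Z] − θ₁·E^{h₁}[Z^∨_p] + θ₂·E^{h₂}[Z^∧_p]. -/
open MeasureTheory Set ProbabilityTheory

noncomputable section

variable {Ω : Type*} [MeasurableSpace Ω]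

/-- An atomless probability measure: every non-null measurable set has a measurable
subset of strictly smaller positive measure. -/
def AtomlessProb (P : Measure Ω) : Prop :=
  ∀ A : Set Ω, MeasurableSet A → 0 < P A →
    ∃ B ⊆ A, MeasurableSet B ∧ 0 < P B ∧ P B < P A

/-- A distortion function: increasing on `[0,1]` with `h 0 = 0` and `h 1 = 1`. -/
def IsDistortion (h : ℝ → ℝ) : Prop :=
  MonotoneOn h (Icc 0 1) ∧ h 0 = 0 ∧ h 1 = 1

/-- The distorted expectation `E^h[Z]`. -/
def distExp (P : Measure Ω) (h : ℝ → ℝ) (Z : Ω → ℝ) : ℝ :=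
  (∫ x in Ioi (0:ℝ), h (P {ω | Z ω > x}).toReal) +
  (∫ x in Iio (0:ℝ), (h (P {ω | Z ω > x}).toReal - 1))

/-- Bounded measurable real random variable. -/
def IsBddRV (X : Ω → ℝ) : Prop :=
  Measurable X ∧ ∃ M : ℝ, ∀ ω, |X ω| ≤ M

/-- X and Y are comonotonic. -/
def Comonotone (P : Measure Ω) (X Y : Ω → ℝ) : Prop :=
  ∃ f g : ℝ → ℝ, Monotone f ∧ Monotone g ∧
    ∀ᵐ ω ∂P, X ω = f (X ω + Y ω) ∧ Y ω = g (X ω + Y ω)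

/-- X and Y are counter-monotonic: X and -Y are comonotonic. -/
def CounterMonotone (P : Measure Ω) (X Y : Ω → ℝ) : Prop :=
  Comonotone P X (fun ω => -Y ω)

def Submodular (c : ℝ → ℝ → ℝ) : Prop :=
  ∀ x₁ y₁ x₂ y₂ : ℝ,
    c (min x₁ x₂) (min y₁ y₂) + c (max x₁ x₂) (max y₁ y₂) ≤ c x₁ y₁ + c x₂ y₂

def Supermodular (c : ℝ → ℝ → ℝ) : Prop :=
  ∀ x₁ y₁ x₂ y₂ : ℝ,
    c x₁ y₁ + c x₂ y₂ ≤ c (min x₁ x₂) (min y₁ y₂) + c (max x₁ x₂) (max y₁ y₂)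

/-- c is monotone: increasing in each argument or decreasing in each argument. -/
def MonotoneCost (c : ℝ → ℝ → ℝ) : Prop :=
  Monotone (fun q : ℝ × ℝ => c q.1 q.2) ∨ Antitone (fun q : ℝ × ℝ => c q.1 q.2)

/-- A 2-copula. -/
def IsCopula (C : ℝ → ℝ → ℝ) : Prop :=
  (∀ u ∈ Icc (0:ℝ) 1, C u 0 = 0 ∧ C 0 u = 0 ∧ C u 1 = u ∧ C 1 u = u) ∧
  (∀ u₁ u₂ v₁ v₂ : ℝ, u₁ ∈ Icc (0:ℝ) 1 → u₂ ∈ Icc (0:ℝ) 1 →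
    v₁ ∈ Icc (0:ℝ) 1 → v₂ ∈ Icc (0:ℝ) 1 → u₁ ≤ u₂ → v₁ ≤ v₂ →
    0 ≤ C u₂ v₂ - C u₂ v₁ - C u₁ v₂ + C u₁ v₁)

/-- (X, Y) has copula C. -/
def HasCopula (P : Measure Ω) (X Y : Ω → ℝ) (C : ℝ → ℝ → ℝ) : Prop :=
  ∀ x y : ℝ, (P {ω | X ω ≤ x ∧ Y ω ≤ y}).toReal =
    C (P {ω | X ω ≤ x}).toReal (P {ω | Y ω ≤ y}).toReal

/-- C is universally optimal for h with linear cost. -/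
def UnivOptimal (P : Measure Ω) (h : ℝ → ℝ) (C : ℝ → ℝ → ℝ) : Prop :=
  ∀ X Y X' Y' : Ω → ℝ, IsBddRV X → IsBddRV Y → IsBddRV X' → IsBddRV Y' →
    HasCopula P X Y C → IdentDistrib X X' P P → IdentDistrib Y Y' P P →
    distExp P h (fun ω => X ω + Y ω) ≤ distExp P h (fun ω => X' ω + Y' ω)

/-- C is universally maximal for h with linear cost. -/
def UnivMaximal (P : Measure Ω) (h : ℝ → ℝ) (C : ℝ → ℝ → ℝ) : Prop :=
  ∀ X Y X' Y' : Ω → ℝ, IsBddRV X → IsBddRV Y → IsBddRV X' → IsBddRV Y' →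
    HasCopula P X Y C → IdentDistrib X X' P P → IdentDistrib Y Y' P P →
    distExp P h (fun ω => X' ω + Y' ω) ≤ distExp P h (fun ω => X ω + Y ω)

/-- C is universally optimal within a class 𝒞 of copulas for h with linear cost. -/
def UnivOptimalWithin (P : Measure Ω) (h : ℝ → ℝ) (C : ℝ → ℝ → ℝ)
    (𝒞 : Set (ℝ → ℝ → ℝ)) : Prop :=
  ∀ X Y X' Y' : Ω → ℝ, IsBddRV X → IsBddRV Y → IsBddRV X' → IsBddRV Y' →
    HasCopula P X Y C → (∃ C' ∈ 𝒞, HasCopula P X' Y' C') →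
    IdentDistrib X X' P P → IdentDistrib Y Y' P P →
    distExp P h (fun ω => X ω + Y ω) ≤ distExp P h (fun ω => X' ω + Y' ω)

/-- C is universally maximal within a class 𝒞 of copulas for h with linear cost. -/
def UnivMaximalWithin (P : Measure Ω) (h : ℝ → ℝ) (C : ℝ → ℝ → ℝ)
    (𝒞 : Set (ℝ → ℝ → ℝ)) : Prop :=
  ∀ X Y X' Y' : Ω → ℝ, IsBddRV X → IsBddRV Y → IsBddRV X' → IsBddRV Y' →
    HasCopula P X Y C → (∃ C' ∈ 𝒞, HasCopula P X' Y' C') →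
    IdentDistrib X X' P P → IdentDistrib Y Y' P P →
    distExp P h (fun ω => X' ω + Y' ω) ≤ distExp P h (fun ω => X ω + Y ω)

/-- The set 𝒞_p of copulas C with C(1-p,1-p) = 1-p. -/
def copulaSet (p : ℝ) : Set (ℝ → ℝ → ℝ) :=
  {C | IsCopula C ∧ C (1 - p) (1 - p) = 1 - p}

/-- The "first comonotonic, then counter-monotonic" copula C^±_p. -/
def Cpm (p : ℝ) (u v : ℝ) : ℝ :=
  if min u v ≤ 1 - p then min u v else max (u + v - 1) (1 - p)

/-- The "first counter-monotonic, then comonotonic" copula C^∓_p. -/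
def Cmp (p : ℝ) (u v : ℝ) : ℝ :=
  if max u v ≤ 1 - p then max (u + v - 1 + p) 0 else min u v

/-- Inverse S-shaped distortion with inflection point p: continuous, concave on (0,p),
convex on (p,1). -/
def IsISS (h : ℝ → ℝ) (p : ℝ) : Prop :=
  ContinuousOn h (Icc 0 1) ∧ ConcaveOn ℝ (Ioo 0 p) h ∧ ConvexOn ℝ (Ioo p 1) h

/-- Strictly inverse S-shaped distortion with inflection point p. -/
def IsStrictISS (h : ℝ → ℝ) (p : ℝ) : Prop :=
  ContinuousOn h (Icc 0 1) ∧ StrictConcaveOn ℝ (Ioo 0 p) h ∧ StrictConvexOn ℝ (Ioo p 1) h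

/-- S-shaped distortion with inflection point p: continuous, convex on (0,p),
concave on (p,1). -/
def IsSS (h : ℝ → ℝ) (p : ℝ) : Prop :=
  ContinuousOn h (Icc 0 1) ∧ ConvexOn ℝ (Ioo 0 p) h ∧ ConcaveOn ℝ (Ioo p 1) h

/-- Strictly S-shaped distortion with inflection point p. -/
def IsStrictSS (h : ℝ → ℝ) (p : ℝ) : Prop :=
  ContinuousOn h (Icc 0 1) ∧ StrictConvexOn ℝ (Ioo 0 p) h ∧ StrictConcaveOn ℝ (Ioo p 1) h

/-- Left quantile of Z at level t. -/
def leftQuantile (P : Measure Ω) (Z : Ω → ℝ) (t : ℝ) : ℝ :=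
  sInf {x : ℝ | t ≤ (P {ω | Z ω ≤ x}).toReal}

/-- W is (a version of) the upper p-tail transform Z^∨_p of Z: its left-quantile
function is t ↦ Q_{(1-p)+pt}(Z). -/
def IsUpperTail (P : Measure Ω) (p : ℝ) (Z W : Ω → ℝ) : Prop :=
  ∀ t ∈ Ioc (0:ℝ) 1, leftQuantile P W t = leftQuantile P Z ((1 - p) + p * t)

/-- W is (a version of) the lower tail transform Z^∧_p of Z: its left-quantile
function is t ↦ Q_{(1-p)t}(Z). -/
def IsLowerTail (P : Measure Ω) (p : ℝ) (Z W : Ω → ℝ) : Prop :=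
  ∀ t ∈ Ioc (0:ℝ) 1, leftQuantile P W t = leftQuantile P Z ((1 - p) * t)

/-- Expected Shortfall at level p. -/
def ES (P : Measure Ω) (p : ℝ) (Z : Ω → ℝ) : ℝ :=
  (1 / (1 - p)) * ∫ r in p..1, leftQuantile P Z r

/-- A continuous function on `[a,b]` that is convex on `(a,b)` is convex on `[a,b]`. -/
theorem convexOn_Icc_of_Ioo {f : ℝ → ℝ} {a b : ℝ} (hab : a < b)
    (hc : ContinuousOn f (Icc a b)) (hf : ConvexOn ℝ (Ioo a b) f) :
    ConvexOn ℝ (Icc a b) f := by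
  refine ⟨convex_Icc a b, fun x hx y hy s t hs ht hst => ?_⟩
  have hmem : (x, y) ∈ closure (Ioo a b ×ˢ Ioo a b) := by
    rw [closure_prod_eq, closure_Ioo hab.ne]; exact ⟨hx, hy⟩
  have hsub : Ioo a b ×ˢ Ioo a b ⊆ Icc a b ×ˢ Icc a b :=
    prod_mono Ioo_subset_Icc_self Ioo_subset_Icc_self
  have h1 : ContinuousOn (fun q : ℝ × ℝ => f q.1) (Icc a b ×ˢ Icc a b) :=
    hc.comp continuous_fst.continuousOn fun q hq => hq.1
  have h2 : ContinuousOn (fun q : ℝ × ℝ => f q.2) (Icc a b ×ˢ Icc a b) :=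
    hc.comp continuous_snd.continuousOn fun q hq => hq.2
  have h3 : ContinuousOn (fun q : ℝ × ℝ => f (s * q.1 + t * q.2)) (Icc a b ×ˢ Icc a b) :=
    hc.comp (by fun_prop) fun q hq => convex_Icc a b hq.1 hq.2 hs ht hst
  exact ContinuousWithinAt.closure_le (f := fun q : ℝ × ℝ => f (s * q.1 + t * q.2))
    (g := fun q : ℝ × ℝ => s * f q.1 + t * f q.2) hmem
    ((h3 _ ⟨hx, hy⟩).mono hsub)
    (((continuousOn_const.mul h1).add (continuousOn_const.mul h2) _ ⟨hx, hy⟩).mono hsub)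
    fun q hq => hf.2 hq.1 hq.2 hs ht hst

/-- A convex function on `[0,1]` vanishing at `0` with nonnegative right derivative there is a
nonnegative multiple of a convex distortion function. -/
theorem exists_convex_distortion {g : ℝ → ℝ} {d : ℝ} (hc : ConvexOn ℝ (Icc 0 1) g)
    (h0 : g 0 = 0) (hg : HasDerivWithinAt g d (Ioi 0) 0) (hd : 0 ≤ d) :
    ∃ k : ℝ → ℝ, 0 ≤ g 1 ∧ IsDistortion k ∧ ConvexOn ℝ (Icc 0 1) k ∧
      ∀ u ∈ Icc (0:ℝ) 1, g u = g 1 * k u := by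
  have hnn : ∀ u ∈ Icc (0:ℝ) 1, 0 ≤ g u := by
    intro u hu
    rcases hu.1.eq_or_lt with rfl | hpos
    · exact h0.ge
    · have := hd.trans (hc.le_slope_of_hasDerivWithinAt_Ioi (by simp) hu hpos hg)
      rw [slope_def_field, h0, sub_zero, sub_zero] at this
      rwa [le_div_iff₀ hpos, zero_mul] at this
  have hmono : MonotoneOn g (Icc 0 1) := by
    intro x hx y hy hxy
    rcases hx.1.eq_or_lt with rfl | hx0
    · rw [h0]; exact hnn y hy
    · have hy0 : 0 < y := hx0.trans_le hxy
      have := hc.2 (left_mem_Icc.2 zero_le_one) hy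
        (sub_nonneg.2 ((div_le_one hy0).2 hxy)) (div_pos hx0 hy0).le (sub_add_cancel 1 (x / y))
      simp only [smul_eq_mul, mul_zero, zero_add, h0, div_mul_cancel₀ _ hy0.ne'] at this
      exact this.trans (mul_le_of_le_one_left (hnn y hy) ((div_le_one hy0).2 hxy))
  have h1 : 0 ≤ g 1 := hnn 1 (by simp)
  rcases h1.eq_or_lt with h1' | h1'
  · refine ⟨id, h1, ⟨monotone_id.monotoneOn _, rfl, rfl⟩, convexOn_id (convex_Icc 0 1), ?_⟩
    intro u hu
    have := hmono hu (by simp) hu.2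
    have := hnn u hu
    rw [← h1', zero_mul]; linarith
  · refine ⟨fun u => (g 1)⁻¹ * g u, h1, ⟨?_, by simp [h0], inv_mul_cancel₀ h1'.ne'⟩, ?_, ?_⟩
    · intro x hx y hy hxy
      exact mul_le_mul_of_nonneg_left (hmono hx hy hxy) (by positivity)
    · exact hc.smul (c := (g 1)⁻¹) (by positivity)
    · intro u _
      simp [mul_inv_cancel_left₀ h1'.ne']

section Distribution

variable {P : Measure Ω} [IsProbabilityMeasure P] {Z : Ω → ℝ}

theorem toReal_setOf_gt (hZ : Measurable Z) (x : ℝ) :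
    (P {ω | Z ω > x}).toReal = 1 - (P {ω | Z ω ≤ x}).toReal := by
  rw [show {ω | Z ω > x} = {ω | Z ω ≤ x}ᶜ by ext; simp]
  exact probReal_compl_eq_one_sub (measurableSet_le hZ measurable_const)

theorem toReal_prob_mem_Icc (s : Set Ω) : (P s).toReal ∈ Icc (0:ℝ) 1 :=
  ⟨ENNReal.toReal_nonneg, measureReal_le_one⟩

theorem leftQuantile_le_iff (hZ : IsBddRV Z) {t : ℝ} (ht : t ∈ Ioc (0:ℝ) 1) (x : ℝ) :
    leftQuantile P Z t ≤ x ↔ t ≤ (P {ω | Z ω ≤ x}).toReal := by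
  obtain ⟨hm, M, hM⟩ := hZ
  have hmono : ∀ y z : ℝ, y ≤ z → (P {ω | Z ω ≤ y}).toReal ≤ (P {ω | Z ω ≤ z}).toReal :=
    fun y z hyz => measureReal_mono (μ := P) fun ω (hω : Z ω ≤ y) => hω.trans hyz
  constructor
  · intro hx
    have : IsProbabilityMeasure (P.map Z) := Measure.isProbabilityMeasure_map hm.aemeasurable
    have hcdf : ∀ y, cdf (P.map Z) y = (P {ω | Z ω ≤ y}).toReal := fun y => by
      rw [cdf_eq_real, map_measureReal_apply hm measurableSet_Iic]; rfl
    have hne : {x : ℝ | t ≤ (P {ω | Z ω ≤ x}).toReal}.Nonempty := by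
      refine ⟨M, ?_⟩
      have : {ω | Z ω ≤ M} = univ := eq_univ_of_forall fun ω => (abs_le.1 (hM ω)).2
      simp [this, ht.2]
    have hgt : ∀ y, x < y → t ≤ cdf (P.map Z) y := by
      intro y hy
      obtain ⟨z, hz, hzy⟩ := exists_lt_of_csInf_lt hne (lt_of_le_of_lt hx hy)
      rw [hcdf]
      exact le_trans hz (hmono z y hzy.le)
    rw [← hcdf]
    refine ge_of_tendsto (((cdf (P.map Z)).right_continuous x).mono Ioi_subset_Ici_self) ?_
    filter_upwards [self_mem_nhdsWithin] with y hy using hgt y hy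
  · intro hx
    refine csInf_le ⟨-M, fun y hy => ?_⟩ hx
    by_contra! hlt
    have : {ω | Z ω ≤ y} = ∅ :=
      eq_empty_of_forall_notMem fun ω hω => (hω.trans_lt hlt).not_ge (abs_le.1 (hM ω)).1
    rw [mem_ofPred_eq, this] at hy
    simp only [measure_empty, ENNReal.toReal_zero] at hy
    linarith [ht.1]

/-- The survival function of the upper tail transform. -/
theorem IsUpperTail.toReal_setOf_gt {p : ℝ} {W : Ω → ℝ} (hp : p ∈ Ioo (0:ℝ) 1) (hZ : IsBddRV Z)
    (hW : IsBddRV W) (h : IsUpperTail P p Z W) (x : ℝ) :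
    (P {ω | W ω > x}).toReal = min ((P {ω | Z ω > x}).toReal / p) 1 := by
  have key : ∀ t ∈ Ioc (0:ℝ) 1,
      t ≤ (P {ω | W ω ≤ x}).toReal ↔ (1 - p) + p * t ≤ (P {ω | Z ω ≤ x}).toReal := by
    intro t ht
    have ht' : (1 - p) + p * t ∈ Ioc (0:ℝ) 1 :=
      ⟨by nlinarith [ht.1, hp.1, hp.2], by nlinarith [ht.2, hp.1]⟩
    rw [← leftQuantile_le_iff hW ht, h t ht, leftQuantile_le_iff hZ ht']
  rw [_root_.toReal_setOf_gt hW.1, _root_.toReal_setOf_gt hZ.1]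
  have hF := toReal_prob_mem_Icc (P := P) {ω | W ω ≤ x}
  have hG := toReal_prob_mem_Icc (P := P) {ω | Z ω ≤ x}
  generalize (P {ω | W ω ≤ x}).toReal = F at *
  generalize (P {ω | Z ω ≤ x}).toReal = G at *
  have hp0 := hp.1
  have hle : F ≤ max ((G - (1 - p)) / p) 0 := by
    by_contra! hlt
    rw [max_lt_iff, div_lt_iff₀ hp0] at hlt
    have := (key F ⟨hlt.2, hF.2⟩).1 le_rfl
    linarith
  have hge : max ((G - (1 - p)) / p) 0 ≤ F := by
    refine max_le ?_ hF.1
    by_cases hpos : 0 < (G - (1 - p)) / p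
    · refine (key _ ⟨hpos, ?_⟩).2 ?_
      · rw [div_le_one hp0]; linarith [hG.2]
      · rw [mul_div_cancel₀ _ hp0.ne']; linarith
    · exact (not_lt.1 hpos).trans hF.1
  rw [le_antisymm hle hge, ← min_sub_sub_left, sub_zero]
  congr 1
  field_simp
  ring

/-- The survival function of the lower tail transform. -/
theorem IsLowerTail.toReal_setOf_gt {p : ℝ} {V : Ω → ℝ} (hp : p ∈ Ioo (0:ℝ) 1) (hZ : IsBddRV Z)
    (hV : IsBddRV V) (h : IsLowerTail P p Z V) (x : ℝ) :
    (P {ω | V ω > x}).toReal = max (((P {ω | Z ω > x}).toReal - p) / (1 - p)) 0 := by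
  have hp0 : 0 < 1 - p := sub_pos.2 hp.2
  have key : ∀ t ∈ Ioc (0:ℝ) 1,
      t ≤ (P {ω | V ω ≤ x}).toReal ↔ (1 - p) * t ≤ (P {ω | Z ω ≤ x}).toReal := by
    intro t ht
    have ht' : (1 - p) * t ∈ Ioc (0:ℝ) 1 :=
      ⟨mul_pos hp0 ht.1, by nlinarith [ht.1, ht.2, hp.1]⟩
    rw [← leftQuantile_le_iff hV ht, h t ht, leftQuantile_le_iff hZ ht']
  rw [_root_.toReal_setOf_gt hV.1, _root_.toReal_setOf_gt hZ.1]
  have hF := toReal_prob_mem_Icc (P := P) {ω | V ω ≤ x}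
  have hG := toReal_prob_mem_Icc (P := P) {ω | Z ω ≤ x}
  generalize (P {ω | V ω ≤ x}).toReal = F at *
  generalize (P {ω | Z ω ≤ x}).toReal = G at *
  have hle : F ≤ min (G / (1 - p)) 1 := by
    refine le_min ?_ hF.2
    rw [le_div_iff₀' hp0]
    rcases hF.1.eq_or_lt with h0 | h0
    · rw [← h0, mul_zero]; exact hG.1
    · exact (key F ⟨h0, hF.2⟩).1 le_rfl
  have hge : min (G / (1 - p)) 1 ≤ F := by
    by_contra! hlt
    have hpos := hF.1.trans_lt hlt
    have := (key _ ⟨hpos, min_le_right _ _⟩).2 (by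
      rw [← le_div_iff₀' hp0]; exact min_le_left _ _)
    linarith
  rw [le_antisymm hle hge, ← max_sub_sub_left, sub_self]
  congr 1
  field_simp
  ring

theorem IsDistortion.antitone_comp {g : ℝ → ℝ} (hg : IsDistortion g) (Z : Ω → ℝ) :
    Antitone fun x : ℝ => g (P {ω | Z ω > x}).toReal := fun x y hxy =>
  hg.1 (toReal_prob_mem_Icc _) (toReal_prob_mem_Icc _)
    (measureReal_mono (μ := P) fun ω (hω : y < Z ω) => lt_of_le_of_lt hxy hω)

theorem IsDistortion.integrableOn_Ioi {g : ℝ → ℝ} (hg : IsDistortion g) (hZ : IsBddRV Z) :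
    IntegrableOn (fun x : ℝ => g (P {ω | Z ω > x}).toReal) (Ioi 0) := by
  obtain ⟨hm, M, hM⟩ := hZ
  refine IntegrableOn.of_forall_sdiff_eq_zero (s := Icc 0 M)
    ((hg.antitone_comp Z).antitoneOn _ |>.integrableOn_isCompact isCompact_Icc)
    measurableSet_Ioi fun x hx => ?_
  have hMx : M < x := by
    by_contra! h
    exact hx.2 ⟨(mem_Ioi.1 hx.1).le, h⟩
  have : {ω | Z ω > x} = ∅ :=
    eq_empty_of_forall_notMem fun ω hω => (hMx.trans hω).not_ge (abs_le.1 (hM ω)).2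
  simp [this, hg.2.1]

theorem IsDistortion.integrableOn_Iio {g : ℝ → ℝ} (hg : IsDistortion g) (hZ : IsBddRV Z) :
    IntegrableOn (fun x : ℝ => g (P {ω | Z ω > x}).toReal - 1) (Iio 0) := by
  obtain ⟨hm, M, hM⟩ := hZ
  have hanti : Antitone fun x : ℝ => g (P {ω | Z ω > x}).toReal - 1 :=
    fun x y hxy => sub_le_sub_right (hg.antitone_comp (P := P) Z hxy) 1
  refine IntegrableOn.of_forall_sdiff_eq_zero (s := Icc (-M) 0)
    ((hanti.antitoneOn _).integrableOn_isCompact isCompact_Icc)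
    measurableSet_Iio fun x hx => ?_
  have hMx : x < -M := by
    by_contra! h
    exact hx.2 ⟨h, (mem_Iio.1 hx.1).le⟩
  have : {ω | Z ω > x} = univ :=
    eq_univ_of_forall fun ω => hMx.trans_le (abs_le.1 (hM ω)).1
  simp [this, hg.2.2]

theorem isDistortion_id : IsDistortion id := ⟨monotone_id.monotoneOn _, rfl, rfl⟩

theorem distExp_id (hZ : IsBddRV Z) : distExp P id Z = ∫ ω, Z ω ∂P := by
  obtain ⟨hm, M, hM⟩ := hZ
  have hint : Integrable Z P :=
    Integrable.of_bound hm.aestronglyMeasurable M (.of_forall hM)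
  have hneg : Integrable (fun ω => -Z ω) P := hint.neg
  rw [integral_eq_integral_pos_part_sub_integral_neg_part hint,
    hint.real_toNNReal.integral_eq_integral_meas_lt (.of_forall fun _ => NNReal.coe_nonneg _),
    hneg.real_toNNReal.integral_eq_integral_meas_le (.of_forall fun _ => NNReal.coe_nonneg _),
    sub_eq_add_neg, distExp]
  congr 1
  · refine setIntegral_congr_fun measurableSet_Ioi fun x (hx : 0 < x) => ?_
    simp [measureReal_def, hx.not_gt]
  · rw [← integral_neg, ← integral_Iic_eq_integral_Iio, ← neg_zero, ← integral_comp_neg_Ioi,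
      neg_zero]
    refine setIntegral_congr_fun measurableSet_Ioi fun x (hx : 0 < x) => ?_
    simp only [id, toReal_setOf_gt hm, measureReal_def, Real.coe_toNNReal',
      le_max_iff, hx.not_ge, or_false, le_neg (a := x)]
    ring

/-- A pointwise relation between distorted survival functions passes to distorted expectations. -/
theorem distExp_eq_of_forall {X Y W V : Ω → ℝ} {h g h₁ h₂ : ℝ → ℝ} {θ θ₁ θ₂ : ℝ}
    (hX : IsBddRV X) (hW : IsBddRV W) (hV : IsBddRV V)
    (hg : IsDistortion g) (h₁d : IsDistortion h₁) (h₂d : IsDistortion h₂)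
    (hsum : θ - θ₁ + θ₂ = 1)
    (H : ∀ x : ℝ, h (P {ω | Y ω > x}).toReal = θ * g (P {ω | X ω > x}).toReal -
      θ₁ * h₁ (P {ω | W ω > x}).toReal + θ₂ * h₂ (P {ω | V ω > x}).toReal) :
    distExp P h Y = θ * distExp P g X - θ₁ * distExp P h₁ W + θ₂ * distExp P h₂ V := by
  have e1 : ∀ x : ℝ, h (P {ω | Y ω > x}).toReal - 1 = θ * (g (P {ω | X ω > x}).toReal - 1) -
      θ₁ * (h₁ (P {ω | W ω > x}).toReal - 1) + θ₂ * (h₂ (P {ω | V ω > x}).toReal - 1) :=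
    fun x => by rw [H]; linear_combination hsum
  simp only [distExp, e1]
  simp only [H]
  have a1 := (hg.integrableOn_Ioi (P := P) hX).const_mul θ
  have a2 := (h₁d.integrableOn_Ioi (P := P) hW).const_mul θ₁
  have a3 := (h₂d.integrableOn_Ioi (P := P) hV).const_mul θ₂
  have b1 := (hg.integrableOn_Iio (P := P) hX).const_mul θ
  have b2 := (h₁d.integrableOn_Iio (P := P) hW).const_mul θ₁
  have b3 := (h₂d.integrableOn_Iio (P := P) hV).const_mul θ₂
  rw [integral_add (by exact a1.sub a2) a3, integral_sub a1 a2,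
    integral_add (by exact b1.sub b2) b3, integral_sub b1 b2]
  simp only [integral_const_mul]
  ring

end Distribution

/-- Decomposition of distorted expectations for ISS distortions with
h'(p⁺) ≥ h'(0⁺): E^h[Z] = θ·E[Z] − θ₁·E^{h₁}[Z^∨_p] + θ₂·E^{h₂}[Z^∧_p] for some
θ, θ₁, θ₂ ≥ 0 and convex distortion functions h₁, h₂. -/
theorem distExp_decomposition_of_ISS
    (P : Measure Ω) [IsProbabilityMeasure P] (hP : AtomlessProb P)
    (h : ℝ → ℝ) (hdist : IsDistortion h)
    (p : ℝ) (hp : p ∈ Ioo (0:ℝ) 1) (hiss : IsISS h p)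
    (d0 dp : ℝ) (hd0 : HasDerivWithinAt h d0 (Ioi 0) 0)
    (hdp : HasDerivWithinAt h dp (Ioi p) p) (hcond : d0 ≤ dp) :
    ∃ θ θ₁ θ₂ : ℝ, 0 ≤ θ ∧ 0 ≤ θ₁ ∧ 0 ≤ θ₂ ∧
    ∃ h₁ h₂ : ℝ → ℝ,
      IsDistortion h₁ ∧ ConvexOn ℝ (Icc 0 1) h₁ ∧
      IsDistortion h₂ ∧ ConvexOn ℝ (Icc 0 1) h₂ ∧
      ∀ Z W V : Ω → ℝ, IsBddRV Z → IsBddRV W → IsBddRV V →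
        IsUpperTail P p Z W → IsLowerTail P p Z V →
        distExp P h Z = θ * (∫ ω, Z ω ∂P) - θ₁ * distExp P h₁ W + θ₂ * distExp P h₂ V := by
  obtain ⟨hp0, hp1⟩ := hp
  have hq : 0 < 1 - p := sub_pos.2 hp1
  obtain ⟨hmono, h00, h11⟩ := hdist
  obtain ⟨hcont, hconc, hconv⟩ := hiss
  have hconc' : ConvexOn ℝ (Icc 0 p) (-h) :=
    convexOn_Icc_of_Ioo hp0 (hcont.mono (Icc_subset_Icc_right hp1.le)).neg hconc.neg
  have hconv' : ConvexOn ℝ (Icc p 1) h :=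
    convexOn_Icc_of_Ioo hp1 (hcont.mono (Icc_subset_Icc_left hp0.le)) hconv
  have hd0' : 0 ≤ d0 := by
    refine ge_of_tendsto ((hasDerivWithinAt_iff_tendsto_slope' self_notMem_Ioi).1 hd0) ?_
    filter_upwards [Ioo_mem_nhdsGT one_pos] with y hy
    rw [slope_def_field]
    exact div_nonneg (sub_nonneg.2 (hmono (by simp) ⟨hy.1.le, hy.2.le⟩ hy.1.le))
      (by linarith [hy.1])
  let g₁ : ℝ → ℝ := fun u => d0 * p * u - h (p * u)
  let g₂ : ℝ → ℝ := fun u => h (p + (1 - p) * u) - h p - d0 * (1 - p) * u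
  have hg₁ : ConvexOn ℝ (Icc 0 1) g₁ := by
    refine ⟨convex_Icc 0 1, fun x hx y hy a b ha hb hab => ?_⟩
    have := hconc'.2 (x := p * x) (y := p * y) ⟨by nlinarith [hx.1], by nlinarith [hx.2]⟩
      ⟨by nlinarith [hy.1], by nlinarith [hy.2]⟩ ha hb hab
    simp only [smul_eq_mul, Pi.neg_apply, g₁] at this ⊢
    rw [show p * (a * x + b * y) = a * (p * x) + b * (p * y) by ring]
    linarith
  have hg₂ : ConvexOn ℝ (Icc 0 1) g₂ := by
    refine ⟨convex_Icc 0 1, fun x hx y hy a b ha hb hab => ?_⟩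
    have := hconv'.2 (x := p + (1 - p) * x) (y := p + (1 - p) * y)
      ⟨by nlinarith [hx.1], by nlinarith [hx.2]⟩
      ⟨by nlinarith [hy.1], by nlinarith [hy.2]⟩ ha hb hab
    simp only [smul_eq_mul, g₂] at this ⊢
    rw [show p + (1 - p) * (a * x + b * y) = a * (p + (1 - p) * x) + b * (p + (1 - p) * y) by
      linear_combination (-p) * hab]
    linear_combination this + h p * hab
  have hd₁ : HasDerivWithinAt g₁ 0 (Ioi 0) 0 := by
    have hin : HasDerivWithinAt (fun u : ℝ => p * u) p (Ioi 0) 0 := by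
      simpa using ((hasDerivAt_id (0:ℝ)).const_mul p).hasDerivWithinAt
    have hout : HasDerivWithinAt h d0 (Ioi 0) (p * 0) := by rwa [mul_zero]
    have hlin : HasDerivWithinAt (fun u : ℝ => d0 * p * u) (d0 * p) (Ioi 0) 0 := by
      simpa using ((hasDerivAt_id (0:ℝ)).const_mul (d0 * p)).hasDerivWithinAt
    exact (hlin.sub (hout.comp 0 hin fun u hu => mul_pos hp0 (mem_Ioi.1 hu))).congr_deriv
      (sub_self _)
  have hd₂ : HasDerivWithinAt g₂ (dp * (1 - p) - d0 * (1 - p)) (Ioi 0) 0 := by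
    have hin : HasDerivWithinAt (fun u : ℝ => p + (1 - p) * u) (1 - p) (Ioi 0) 0 := by
      simpa using (((hasDerivAt_id (0:ℝ)).const_mul (1 - p)).const_add p).hasDerivWithinAt
    have hout : HasDerivWithinAt h dp (Ioi p) (p + (1 - p) * 0) := by rwa [mul_zero, add_zero]
    have hlin : HasDerivWithinAt (fun u : ℝ => d0 * (1 - p) * u) (d0 * (1 - p)) (Ioi 0) 0 := by
      simpa using ((hasDerivAt_id (0:ℝ)).const_mul (d0 * (1 - p))).hasDerivWithinAt
    exact ((hout.comp 0 hin fun u hu =>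
      lt_add_of_pos_right p (mul_pos hq (mem_Ioi.1 hu))).sub_const (h p)).sub hlin
  obtain ⟨h₁, hθ₁, h₁d, h₁c, h₁e⟩ :=
    exists_convex_distortion hg₁ (by simp [g₁, h00]) hd₁ le_rfl
  obtain ⟨h₂, hθ₂, h₂d, h₂c, h₂e⟩ :=
    exists_convex_distortion hg₂ (by simp [g₂]) hd₂
      (by rw [← sub_mul]; exact mul_nonneg (sub_nonneg.2 hcond) hq.le)
  refine ⟨d0, g₁ 1, g₂ 1, hd0', hθ₁, hθ₂, h₁, h₂, h₁d, h₁c, h₂d, h₂c, ?_⟩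
  intro Z W V hZ hW hV hZW hZV
  rw [← distExp_id hZ]
  refine distExp_eq_of_forall hZ hW hV isDistortion_id h₁d h₂d ?_ fun x => ?_
  · simp only [g₁, g₂, mul_one, add_sub_cancel, h11]
    ring
  rw [hZW.toReal_setOf_gt ⟨hp0, hp1⟩ hZ hW, hZV.toReal_setOf_gt ⟨hp0, hp1⟩ hZ hV, id]
  obtain ⟨hs0, hs1⟩ := toReal_prob_mem_Icc (P := P) {ω | Z ω > x}
  generalize (P {ω | Z ω > x}).toReal = s at *
  rcases le_total s p with hsp | hsp
  · have hle : s / p ≤ 1 := (div_le_one hp0).2 hsp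
    rw [min_eq_left hle, max_eq_right (div_nonpos_of_nonpos_of_nonneg (by linarith) hq.le),
      ← h₁e _ ⟨by positivity, hle⟩, h₂d.2.1]
    simp only [g₁, mul_div_cancel₀ _ hp0.ne', mul_assoc]
    ring
  · have hge : 0 ≤ (s - p) / (1 - p) := div_nonneg (by linarith) hq.le
    rw [min_eq_right ((one_le_div hp0).2 hsp), max_eq_left hge,
      ← h₂e _ ⟨hge, (div_le_one hq).2 (by linarith)⟩, h₁d.2.2]
    simp only [g₁, g₂, mul_div_cancel₀ _ hq.ne', mul_assoc, add_sub_cancel]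
    ring_nf
end
end

section
/- Sufficiency in the S-shaped characterization: Let h be an S-shaped distortion function with inflection point p∈(0,1), and suppose the right derivatives satisfy h'(p⁺) ≤ h'(0⁺). Then the copula C^±_p is universally maximal for h with linear cost: for all bounded random variables X, Y with copula C^±_p and all bounded X', Y' with X' equal in distribution to X and Y' equal in distribution to Y, E^h[X+Y] ≥ E^h[X'+Y']. -/
open MeasureTheory Set ProbabilityTheory

noncomputable section

variable {Ω : Type*} [MeasurableSpace Ω]

/-- A function convex on an open interval and continuous on its closure is convex there. -/
lemma ConvexOn.Icc_of_Ioo {f : ℝ → ℝ} {a b : ℝ} (hab : a < b) (hf : ConvexOn ℝ (Ioo a b) f)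
    (hc : ContinuousOn f (Icc a b)) : ConvexOn ℝ (Icc a b) f := by
  refine ⟨convex_Icc a b, fun x hx y hy u v hu hv huv => ?_⟩
  have hcl : closure (Ioo a b ×ˢ Ioo a b) = Icc a b ×ˢ Icc a b := by
    rw [closure_prod_eq, closure_Ioo hab.ne]
  refine le_on_closure (s := Ioo a b ×ˢ Ioo a b)
    (f := fun q : ℝ × ℝ => f (u • q.1 + v • q.2)) (g := fun q => u • f q.1 + v • f q.2)
    (x := (x, y)) (fun q hq => hf.2 hq.1 hq.2 hu hv huv) ?_ ?_ ?_
  · rw [hcl]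
    exact hc.comp (by fun_prop) fun q hq => convex_Icc a b hq.1 hq.2 hu hv huv
  · rw [hcl]
    exact ((hc.comp continuousOn_fst fun q hq => hq.1).const_smul u).add
      ((hc.comp continuousOn_snd fun q hq => hq.2).const_smul v)
  · rw [hcl]
    exact ⟨hx, hy⟩

lemma ConcaveOn.Icc_of_Ioo {f : ℝ → ℝ} {a b : ℝ} (hab : a < b) (hf : ConcaveOn ℝ (Ioo a b) f)
    (hc : ContinuousOn f (Icc a b)) : ConcaveOn ℝ (Icc a b) f :=
  neg_convexOn_iff.1 (hf.neg.Icc_of_Ioo hab hc.neg)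

/-- Slope of `f` between consecutive points of the sequence `t`. -/
def gridSlope (f : ℝ → ℝ) (t : ℕ → ℝ) (i : ℕ) : ℝ := slope f (t i) (t (i + 1))

/-- The piecewise linear interpolation of `f - f (t 0)` at `t 0, …, t n`, constant outside
`[t 0, t n]`. -/
def gridInterp (f : ℝ → ℝ) (t : ℕ → ℝ) (n : ℕ) (x : ℝ) : ℝ :=
  ∑ i ∈ Finset.range n, gridSlope f t i * (min x (t (i + 1)) - min x (t i))

lemma abs_gridInterp_sub_le {f : ℝ → ℝ} {t : ℕ → ℝ} (ht : StrictMono t) {n : ℕ}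
    (hf : MonotoneOn f (Icc (t 0) (t n))) {ε : ℝ} (hε0 : 0 ≤ ε)
    (hε : ∀ i < n, f (t (i + 1)) - f (t i) ≤ ε) {x : ℝ} (hx : t 0 ≤ x) :
    |gridInterp f t n x - (f (min x (t n)) - f (t 0))| ≤ ε := by
  suffices H : ∀ j ≤ n, |gridInterp f t j x - (f (min x (t j)) - f (t 0))| ≤ ε ∧
      (t j ≤ x → gridInterp f t j x = f (t j) - f (t 0)) from (H n le_rfl).1
  intro j hj
  induction j with
  | zero => simp [gridInterp, min_eq_right hx, hε0]
  | succ j ih =>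
    obtain ⟨ih1, ih2⟩ := ih (by omega)
    have hlt : t j < t (j + 1) := ht (by omega)
    have hmul : gridSlope f t j * (t (j + 1) - t j) = f (t (j + 1)) - f (t j) := by
      rw [gridSlope, mul_comm, ← smul_eq_mul, sub_smul_slope, vsub_eq_sub]
    have hmem : ∀ y, t j ≤ y → y ≤ t (j + 1) → y ∈ Icc (t 0) (t n) := fun y h1 h2 =>
      ⟨(ht.monotone (Nat.zero_le j)).trans h1, h2.trans (ht.monotone hj)⟩
    have hstep : gridInterp f t (j + 1) x = gridInterp f t j x +
        gridSlope f t j * (min x (t (j + 1)) - min x (t j)) := Finset.sum_range_succ _ _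
    have htop : t (j + 1) ≤ x → gridInterp f t (j + 1) x = f (t (j + 1)) - f (t 0) := by
      intro h
      rw [hstep, ih2 (hlt.le.trans h), min_eq_right h, min_eq_right (hlt.le.trans h), hmul]
      ring
    refine ⟨?_, htop⟩
    rcases le_or_gt (t (j + 1)) x with h | h
    · rw [htop h, min_eq_right h, sub_self, abs_zero]
      exact hε0
    rcases le_or_gt x (t j) with h' | h'
    · rw [hstep, min_eq_left h', min_eq_left h.le, sub_self, mul_zero, add_zero]
      rwa [min_eq_left h'] at ih1
    · rw [hstep, ih2 h'.le, min_eq_left h.le, min_eq_right h'.le]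
      have h1 := hf (hmem _ le_rfl hlt.le) (hmem _ h'.le h.le) h'.le
      have h2 := hf (hmem _ h'.le h.le) (hmem _ hlt.le le_rfl) h.le
      have h3 := hε j (by omega)
      have hs : 0 ≤ gridSlope f t j := by
        by_contra! hneg
        nlinarith
      have h4 : 0 ≤ gridSlope f t j * (x - t j) := mul_nonneg hs (by linarith)
      have h5 : gridSlope f t j * (x - t j) ≤ f (t (j + 1)) - f (t j) := by
        rw [← hmul]
        gcongr
      rw [abs_le]
      constructor <;> linarith

/-- A continuous monotone function on `[a, b]` is approximated by interpolation at equidistant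
points. -/
lemma exists_grid {f : ℝ → ℝ} {a b : ℝ} (hab : a < b) (hf : MonotoneOn f (Icc a b))
    (hc : ContinuousOn f (Icc a b)) {ε : ℝ} (hε : 0 < ε) :
    ∃ t : ℕ → ℝ, ∃ n, StrictMono t ∧ 0 < n ∧ t 0 = a ∧ t n = b ∧
      ∀ x, a ≤ x → |gridInterp f t n x - (f (min x b) - f a)| ≤ ε := by
  obtain ⟨δ, hδ, H⟩ := Metric.uniformContinuousOn_iff.1
    (isCompact_Icc.uniformContinuousOn_of_continuous hc) ε hε
  obtain ⟨n, hn⟩ := exists_nat_gt ((b - a) / δ)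
  have hn0 : (0 : ℝ) < n := (div_pos (sub_pos.2 hab) hδ).trans hn
  have hd : 0 < (b - a) / n := div_pos (sub_pos.2 hab) hn0
  let t : ℕ → ℝ := fun i => a + i * ((b - a) / n)
  have ht : StrictMono t := fun i j hij => by
    have : (i : ℝ) < j := by exact_mod_cast hij
    simp only [t]
    gcongr
  have ht0 : t 0 = a := by simp [t]
  have htn : t n = b := by simp only [t]; field_simp; ring
  refine ⟨t, n, ht, by exact_mod_cast hn0, ht0, htn, fun x hx => ?_⟩
  have hmem : ∀ i ≤ n, t i ∈ Icc a b := fun i hi =>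
    ⟨ht0 ▸ ht.monotone (Nat.zero_le i), htn ▸ ht.monotone hi⟩
  have := abs_gridInterp_sub_le (f := f) ht (n := n) (by rwa [ht0, htn]) hε.le (fun i hi => by
    have h1 : dist (t (i + 1)) (t i) < δ := by
      have : t (i + 1) - t i = (b - a) / n := by simp only [t]; push_cast; ring
      rw [Real.dist_eq, this, abs_of_pos hd]
      rw [div_lt_iff₀ hδ] at hn
      rw [div_lt_iff₀ hn0]
      linarith
    exact (le_abs_self _).trans (H _ (hmem _ hi) _ (hmem _ hi.le) h1).le) (ht0.trans_le hx)
  rwa [ht0, htn] at this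

/-- Abel summation against increasing weights. -/
lemma sum_mul_sub_ge_of_increasing {σ E : ℕ → ℝ} {n : ℕ} {d : ℝ} (hn : 0 < n) (hd : d ≤ σ 0)
    (hσ : ∀ i, i + 1 < n → σ i ≤ σ (i + 1)) (hE : ∀ i ≤ n, E i ≤ E n) :
    d * (E n - E 0) ≤ ∑ i ∈ Finset.range n, σ i * (E (i + 1) - E i) := by
  obtain ⟨m, rfl⟩ := Nat.exists_eq_succ_of_ne_zero hn.ne'
  suffices H : ∀ j ≤ m, d * (E (m + 1) - E 0) ≤
      ∑ i ∈ Finset.range j, σ i * (E (i + 1) - E i) + σ j * (E (m + 1) - E j) by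
    rw [Finset.sum_range_succ]
    exact H m le_rfl
  intro j hj
  induction j with
  | zero =>
    simpa using mul_le_mul_of_nonneg_right hd (sub_nonneg.2 (hE 0 (by omega)))
  | succ j ih =>
    rw [Finset.sum_range_succ]
    have := mul_nonneg (sub_nonneg.2 (hσ j (by omega))) (sub_nonneg.2 (hE (j + 1) (by omega)))
    have := ih (by omega)
    simp only [Nat.succ_eq_add_one] at *
    linarith

/-- Abel summation against decreasing nonnegative weights. -/
lemma sum_mul_sub_ge_of_decreasing {τ D : ℕ → ℝ} {n : ℕ} {d : ℝ} (hd : τ 0 ≤ d)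
    (hn : 0 < n) (hτ : ∀ i, i + 1 < n → τ (i + 1) ≤ τ i) (hτ0 : ∀ i < n, 0 ≤ τ i)
    (hD : ∀ i ≤ n, 0 ≤ D i) :
    -(d * D 0) ≤ ∑ i ∈ Finset.range n, τ i * (D (i + 1) - D i) := by
  obtain ⟨m, rfl⟩ := Nat.exists_eq_succ_of_ne_zero hn.ne'
  suffices H : ∀ j ≤ m, -(d * D 0) ≤
      ∑ i ∈ Finset.range j, τ i * (D (i + 1) - D i) - τ j * D j by
    rw [Finset.sum_range_succ]
    have := mul_nonneg (hτ0 m (by omega)) (hD (m + 1) le_rfl)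
    linarith [H m le_rfl]
  intro j hj
  induction j with
  | zero => simpa using mul_le_mul_of_nonneg_right hd (hD 0 (by omega))
  | succ j ih =>
    rw [Finset.sum_range_succ]
    have := mul_nonneg (sub_nonneg.2 (hτ j (by omega))) (hD (j + 1) (by omega))
    linarith [ih (by omega)]

lemma gridInterp_of_le {f : ℝ → ℝ} {t : ℕ → ℝ} (ht : Monotone t) {n : ℕ} {x : ℝ}
    (hx : x ≤ t 0) : gridInterp f t n x = 0 :=
  Finset.sum_eq_zero fun i _ => by
    rw [min_eq_left (hx.trans (ht (Nat.zero_le _))), min_eq_left (hx.trans (ht (Nat.zero_le _))),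
      sub_self, mul_zero]

lemma intervalIntegrable_min_const {f : ℝ → ℝ} (hf : Antitone f) (s a b : ℝ) :
    IntervalIntegrable (fun x => min (f x) s) volume a b :=
  Antitone.intervalIntegrable fun _ _ hxy => min_le_min_right s (hf hxy)

lemma intervalIntegrable_gridInterp_comp {f : ℝ → ℝ} (hf : Antitone f) (h : ℝ → ℝ) (t : ℕ → ℝ)
    (n : ℕ) (a b : ℝ) : IntervalIntegrable (fun x => gridInterp h t n (f x)) volume a b := by
  simp only [gridInterp]
  have := IntervalIntegrable.sum (μ := volume) (a := a) (b := b) (Finset.range n)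
    (f := fun i x => gridSlope h t i * (min (f x) (t (i + 1)) - min (f x) (t i)))
    fun i _ => ((intervalIntegrable_min_const hf _ a b).sub
      (intervalIntegrable_min_const hf _ a b)).const_mul _
  convert! this using 1
  ext x
  simp

lemma integral_gridInterp_comp {f : ℝ → ℝ} (hf : Antitone f) (h : ℝ → ℝ) (t : ℕ → ℝ) (n : ℕ)
    (a b : ℝ) : ∫ x in a..b, gridInterp h t n (f x) =
      ∑ i ∈ Finset.range n, gridSlope h t i *
        ((∫ x in a..b, min (f x) (t (i + 1))) - ∫ x in a..b, min (f x) (t i)) := by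
  simp only [gridInterp]
  rw [intervalIntegral.integral_finsetSum fun i _ =>
    ((intervalIntegrable_min_const hf _ a b).sub
      (intervalIntegrable_min_const hf _ a b)).const_mul _]
  refine Finset.sum_congr rfl fun i _ => ?_
  rw [intervalIntegral.integral_const_mul, intervalIntegral.integral_sub
    (intervalIntegrable_min_const hf _ a b) (intervalIntegrable_min_const hf _ a b)]

/-- An S-shaped distortion with `h'(p⁺) ≤ h'(0⁺)` is, up to `ε`, a sum of piecewise linear
interpolations for which the truncated integrals control the integral of the composition. -/
lemma IsSS.exists_approx {h : ℝ → ℝ} (hdist : IsDistortion h)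
    {p : ℝ} (hp : p ∈ Ioo (0:ℝ) 1) (hss : IsSS h p)
    {d0 dp : ℝ} (hd0 : HasDerivWithinAt h d0 (Ioi 0) 0)
    (hdp : HasDerivWithinAt h dp (Ioi p) p) (hcond : dp ≤ d0) {ε : ℝ} (hε : 0 < ε) :
    ∃ (t u : ℕ → ℝ) (n m : ℕ),
      (∀ x ∈ Icc (0:ℝ) 1, |gridInterp h t n x + gridInterp h u m x - h x| ≤ 2 * ε) ∧
      ∀ D : ℝ → ℝ, D 0 = 0 → (∀ s ∈ Icc 0 p, D s ≤ D p) → (∀ s ∈ Icc p 1, 0 ≤ D s) →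
        0 ≤ ∑ i ∈ Finset.range n, gridSlope h t i * (D (t (i + 1)) - D (t i)) +
          ∑ i ∈ Finset.range m, gridSlope h u i * (D (u (i + 1)) - D (u i)) := by
  obtain ⟨hmono, h0, -⟩ := hdist
  obtain ⟨hcont, hconv, hconc⟩ := hss
  obtain ⟨hp0, hp1⟩ := hp
  have hsub0 : Icc 0 p ⊆ Icc 0 1 := Icc_subset_Icc_right hp1.le
  have hsub1 : Icc p 1 ⊆ Icc 0 1 := Icc_subset_Icc_left hp0.le
  replace hconv := hconv.Icc_of_Ioo hp0 (hcont.mono hsub0)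
  replace hconc := hconc.Icc_of_Ioo hp1 (hcont.mono hsub1)
  obtain ⟨t, n, ht, hn, ht0, htn, hta⟩ :=
    exists_grid hp0 (hmono.mono hsub0) (hcont.mono hsub0) hε
  obtain ⟨u, m, hu, hm, hu0, hum, hua⟩ :=
    exists_grid hp1 (hmono.mono hsub1) (hcont.mono hsub1) hε
  have htmem : ∀ i ≤ n, t i ∈ Icc 0 p := fun i hi =>
    ⟨ht0 ▸ ht.monotone (Nat.zero_le i), htn ▸ ht.monotone hi⟩
  have humem : ∀ i ≤ m, u i ∈ Icc p 1 := fun i hi =>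
    ⟨hu0 ▸ hu.monotone (Nat.zero_le i), hum ▸ hu.monotone hi⟩
  refine ⟨t, u, n, m, fun x hx => ?_, fun D hD0 hDt hDu => ?_⟩
  · have h1 := hta x hx.1
    rw [h0, sub_zero] at h1
    rcases le_total x p with hxp | hxp
    · rw [gridInterp_of_le hu.monotone (hxp.trans_eq hu0.symm), add_zero]
      rw [min_eq_left hxp] at h1
      linarith
    · have h2 := hua x hxp
      rw [min_eq_left hx.2] at h2
      rw [min_eq_right hxp] at h1
      rw [abs_le] at *
      constructor <;> linarith
  · have h1 := sum_mul_sub_ge_of_increasing (σ := gridSlope h t) (E := fun i => D (t i))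
      (d := d0) hn
      (by
        have := hconv.le_slope_of_hasDerivWithinAt_Ioi (htmem 0 hn.le) (htmem 1 hn)
          (ht zero_lt_one) (by rwa [ht0])
        simpa [gridSlope] using this)
      (fun i hi => by
        simp only [gridSlope, slope_def_field]
        exact hconv.slope_mono_adjacent (htmem i (by omega)) (htmem (i + 2) (by omega))
          (ht (by omega)) (ht (by omega)))
      (fun i hi => by rw [htn]; exact hDt _ (htmem i hi))
    have h2 := sum_mul_sub_ge_of_decreasing (τ := gridSlope h u) (D := fun i => D (u i))
      (d := dp)
      (by
        have := hconc.slope_le_of_hasDerivWithinAt_Ioi (humem 0 hm.le) (humem 1 hm)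
          (hu zero_lt_one) (by rwa [hu0])
        simpa [gridSlope] using this) hm
      (fun i hi => by
        simp only [gridSlope, slope_def_field]
        exact hconc.slope_anti_adjacent (humem i (by omega)) (humem (i + 2) (by omega))
          (hu (by omega)) (hu (by omega)))
      (fun i hi => by
        rw [gridSlope, slope_def_field]
        exact div_nonneg (sub_nonneg.2 (hmono (hsub1 (humem i hi.le)) (hsub1 (humem (i + 1) hi))
          (hu.monotone (by omega)))) (sub_nonneg.2 (hu.monotone (by omega))))
      (fun i hi => hDu _ (humem i hi))
    rw [ht0, htn, hD0, sub_zero] at h1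
    rw [hu0] at h2
    have := mul_nonneg (sub_nonneg.2 hcond) (hDu p ⟨le_rfl, hp1.le⟩)
    linarith

/-- Comparison of `∫ h ∘ f` and `∫ h ∘ g` through the truncated integrals of `f` and `g`. -/
lemma IsSS.integral_comp_le {h : ℝ → ℝ} (hdist : IsDistortion h)
    {p : ℝ} (hp : p ∈ Ioo (0:ℝ) 1) (hss : IsSS h p)
    {d0 dp : ℝ} (hd0 : HasDerivWithinAt h d0 (Ioi 0) 0)
    (hdp : HasDerivWithinAt h dp (Ioi p) p) (hcond : dp ≤ d0)
    {f g : ℝ → ℝ} (hf : Antitone f) (hg : Antitone g)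
    (hf01 : ∀ x, f x ∈ Icc (0:ℝ) 1) (hg01 : ∀ x, g x ∈ Icc (0:ℝ) 1) {a b : ℝ} (hab : a ≤ b)
    (hlow : ∀ s ∈ Icc 0 p, (∫ x in a..b, min (g x) s) - (∫ x in a..b, min (f x) s) ≤
      (∫ x in a..b, min (g x) p) - ∫ x in a..b, min (f x) p)
    (hup : ∀ s ∈ Icc p 1, (∫ x in a..b, min (f x) s) ≤ ∫ x in a..b, min (g x) s) :
    ∫ x in a..b, h (f x) ≤ ∫ x in a..b, h (g x) := by
  have hint : ∀ k : ℝ → ℝ, Antitone k → (∀ x, k x ∈ Icc (0:ℝ) 1) →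
      IntervalIntegrable (fun x => h (k x)) volume a b := fun k hk hk01 =>
    Antitone.intervalIntegrable fun x y hxy => hdist.1 (hk01 y) (hk01 x) (hk hxy)
  refine le_of_forall_pos_le_add fun η hη => ?_
  obtain ⟨ε, hε, hεη⟩ : ∃ ε : ℝ, 0 < ε ∧ 4 * ε * (b - a) ≤ η :=
    ⟨η / (4 * (b - a + 1)), by have := sub_nonneg.2 hab; positivity, by
      have := sub_nonneg.2 hab
      have h1 : 0 < b - a + 1 := by linarith
      rw [mul_div_assoc', div_mul_eq_mul_div, div_le_iff₀ (by positivity)]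
      nlinarith⟩
  obtain ⟨t, u, n, m, happ, hpos⟩ := IsSS.exists_approx hdist hp hss hd0 hdp hcond hε
  have hpos := hpos (fun s => (∫ x in a..b, min (g x) s) - ∫ x in a..b, min (f x) s)
    (by simp [min_eq_right (hf01 _).1, min_eq_right (hg01 _).1]) hlow
    (fun s hs => sub_nonneg.2 (hup s hs))
  have happrox : ∀ k : ℝ → ℝ, Antitone k → (∀ x, k x ∈ Icc (0:ℝ) 1) →
      |(∫ x in a..b, gridInterp h t n (k x)) + (∫ x in a..b, gridInterp h u m (k x)) -
        ∫ x in a..b, h (k x)| ≤ 2 * ε * (b - a) := fun k hk hk01 => by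
    have ht := intervalIntegrable_gridInterp_comp hk h t n a b
    have hu := intervalIntegrable_gridInterp_comp hk h u m a b
    rw [← intervalIntegral.integral_add ht hu,
      ← intervalIntegral.integral_sub (ht.add hu) (hint k hk hk01), ← Real.norm_eq_abs]
    refine (intervalIntegral.norm_integral_le_of_norm_le_const
      (fun x _ => happ (k x) (hk01 x))).trans_eq ?_
    rw [abs_of_nonneg (sub_nonneg.2 hab)]
  have hF := abs_le.1 (happrox f hf hf01)
  have hG := abs_le.1 (happrox g hg hg01)
  rw [integral_gridInterp_comp hf, integral_gridInterp_comp hf] at hF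
  rw [integral_gridInterp_comp hg, integral_gridInterp_comp hg] at hG
  have hsplit : ∀ (v : ℕ → ℝ) (k : ℕ), ∑ i ∈ Finset.range k, gridSlope h v i *
      (((∫ x in a..b, min (g x) (v (i + 1))) - ∫ x in a..b, min (f x) (v (i + 1))) -
        ((∫ x in a..b, min (g x) (v i)) - ∫ x in a..b, min (f x) (v i))) =
      ∑ i ∈ Finset.range k, gridSlope h v i *
        ((∫ x in a..b, min (g x) (v (i + 1))) - ∫ x in a..b, min (g x) (v i)) -
      ∑ i ∈ Finset.range k, gridSlope h v i *
        ((∫ x in a..b, min (f x) (v (i + 1))) - ∫ x in a..b, min (f x) (v i)) := fun v k => by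
    rw [← Finset.sum_sub_distrib]
    exact Finset.sum_congr rfl fun i _ => by ring
  simp only [hsplit] at hpos
  linarith [hF.1, hG.2]

lemma Antitone.exists_level {f : ℝ → ℝ} (hf : Antitone f) {B s : ℝ} (hB : 0 ≤ B)
    (hlo : ∀ x < -B, s ≤ f x) (hhi : ∀ x > B, f x ≤ s) :
    ∃ a ∈ Icc (-B) B, (∀ x < a, s ≤ f x) ∧ ∀ x > a, f x ≤ s := by
  let S : Set ℝ := {x | x ≤ B ∧ (x ≤ -B ∨ s ≤ f x)}
  have hbdd : BddAbove S := ⟨B, fun x hx => hx.1⟩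
  have hne : -B ∈ S := ⟨by linarith, Or.inl le_rfl⟩
  refine ⟨sSup S, ⟨le_csSup hbdd hne, csSup_le ⟨_, hne⟩ fun x hx => hx.1⟩, fun x hx => ?_,
    fun x hx => ?_⟩
  · obtain ⟨y, hy, hxy⟩ := exists_lt_of_lt_csSup ⟨_, hne⟩ hx
    rcases hy.2 with h | h
    · exact hlo x (hxy.trans_le h)
    · exact h.trans (hf hxy.le)
  · by_contra! hlt
    have hxB : x ≤ B := by
      by_contra! h
      exact absurd (hhi x h) (not_le.2 hlt)
    exact absurd (le_csSup hbdd ⟨hxB, Or.inr hlt.le⟩) (not_le.2 hx)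

section Tail

variable {P : Measure Ω}

lemma antitone_measureReal_gt (P : Measure Ω) [IsFiniteMeasure P] (X : Ω → ℝ) :
    Antitone fun x => P.real {ω | X ω > x} := fun _ _ hxy =>
  measureReal_mono fun _ hω => lt_of_le_of_lt hxy hω

lemma measureReal_gt_le_of_forall_gt [IsFiniteMeasure P] {V : Ω → ℝ} {a s : ℝ}
    (h : ∀ x > a, P.real {ω | V ω > x} ≤ s) : P.real {ω | V ω > a} ≤ s := by
  obtain ⟨u, hu, hua, hlim⟩ := exists_seq_strictAnti_tendsto a
  have hset : {ω | V ω > a} = ⋃ n, {ω | V ω > u n} := by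
    ext ω
    simp only [mem_ofPred_eq, mem_iUnion]
    refine ⟨fun hω => ?_, fun ⟨n, hn⟩ => (hua n).trans hn⟩
    exact (hlim.eventually_lt_const hω).exists
  have htend := tendsto_measure_iUnion_atTop (μ := P) (s := fun n => {ω | V ω > u n})
    fun m n hmn ω hω => lt_of_le_of_lt (hu.antitone hmn) hω
  rw [← hset] at htend
  have := (ENNReal.tendsto_toReal (measure_ne_top P _)).comp htend
  exact le_of_tendsto' this fun n => h _ (hua n)

lemma le_measureReal_ge_of_forall_lt [IsFiniteMeasure P] {V : Ω → ℝ} (hV : Measurable V) {a s : ℝ}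
    (h : ∀ x < a, s ≤ P.real {ω | V ω > x}) : s ≤ P.real {ω | a ≤ V ω} := by
  obtain ⟨u, hu, hua, hlim⟩ := exists_seq_strictMono_tendsto a
  have hset : {ω | a ≤ V ω} = ⋂ n, {ω | V ω > u n} := by
    ext ω
    simp only [mem_ofPred_eq, mem_iInter]
    exact ⟨fun hω n => (hua n).trans_le hω, fun hω => le_of_tendsto' hlim fun n => (hω n).le⟩
  have htend := tendsto_measure_iInter_atTop (μ := P) (s := fun n => {ω | V ω > u n})
    (fun n => (measurableSet_lt measurable_const hV).nullMeasurableSet)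
    (fun m n hmn ω hω => lt_of_le_of_lt (hu.monotone hmn) hω) ⟨0, measure_ne_top P _⟩
  rw [← hset] at htend
  have := (ENNReal.tendsto_toReal (measure_ne_top P _)).comp htend
  exact ge_of_tendsto' this fun n => h _ (hua n)

lemma exists_quantile [IsProbabilityMeasure P] {X : Ω → ℝ} (hX : Measurable X) {M : ℝ}
    (hM : ∀ ω, |X ω| ≤ M) {s : ℝ} (hs : s ∈ Icc (0:ℝ) 1) :
    ∃ a, (∀ x < a, s ≤ P.real {ω | X ω > x}) ∧ P.real {ω | X ω > a} ≤ s ∧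
      s ≤ P.real {ω | a ≤ X ω} := by
  obtain ⟨ω₀⟩ := nonempty_of_isProbabilityMeasure P
  obtain ⟨a, -, h1, h2⟩ := (antitone_measureReal_gt P X).exists_level
    (B := M) (s := s) ((abs_nonneg _).trans (hM ω₀))
    (fun x hx => by
      have : {ω | X ω > x} = univ := eq_univ_of_forall fun ω =>
        hx.trans_le (abs_le.1 (hM ω)).1
      simp [this, hs.2])
    (fun x hx => by
      have : {ω | X ω > x} = ∅ := eq_empty_of_forall_notMem fun ω hω =>
        absurd ((lt_trans hx hω).trans_le (abs_le.1 (hM ω)).2) (lt_irrefl _)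
      simp [this, hs.1])
  exact ⟨a, h1, measureReal_gt_le_of_forall_gt h2, le_measureReal_ge_of_forall_lt hX h1⟩

/-- Between nested sets of mass at most `s` and at least `s` there is a submeasure of mass `s`. -/
lemma exists_measure_between [IsFiniteMeasure P] {A B : Set Ω} (hA : MeasurableSet A)
    (hB : MeasurableSet B) (hAB : A ⊆ B) {s : ℝ} (hsA : P.real A ≤ s) (hsB : s ≤ P.real B) :
    ∃ Q : Measure Ω, Q ≤ P ∧ Q.real univ = s ∧ Q Bᶜ = 0 ∧ ∀ C ⊆ A, Q C = P C := by
  obtain ⟨c, hc0, hc1, hc⟩ : ∃ c : ℝ, 0 ≤ c ∧ c ≤ 1 ∧ P.real A + c * P.real (B \ A) = s := by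
    have hBA : P.real (B \ A) = P.real B - P.real A := measureReal_sdiff hAB hA
    rcases (measureReal_nonneg (μ := P) (s := B \ A)).eq_or_lt with h | h
    · exact ⟨0, le_rfl, zero_le_one, by linarith⟩
    · refine ⟨(s - P.real A) / P.real (B \ A), div_nonneg (by linarith) h.le,
        (div_le_one h).2 (by linarith), ?_⟩
      rw [div_mul_cancel₀ _ h.ne']
      ring
  have hc1' : ENNReal.ofReal c ≤ 1 := ENNReal.ofReal_le_one.2 hc1
  refine ⟨P.restrict A + ENNReal.ofReal c • P.restrict (B \ A), ?_, ?_, ?_, ?_⟩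
  · calc P.restrict A + ENNReal.ofReal c • P.restrict (B \ A)
        ≤ P.restrict A + P.restrict (B \ A) := by
          gcongr
          exact Measure.le_intro fun C hC _ => by
            simpa using mul_le_of_le_one_left zero_le hc1'
      _ = P.restrict (A ∪ B \ A) := (Measure.restrict_union disjoint_sdiff_right (hB.diff hA)).symm
      _ ≤ P := Measure.restrict_le_self
  · rw [← hc]
    simp only [Measure.real, Measure.add_apply, Measure.smul_apply, smul_eq_mul,
      Measure.restrict_apply_univ]
    rw [ENNReal.toReal_add (by finiteness) (by finiteness), ENNReal.toReal_mul,
      ENNReal.toReal_ofReal hc0]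
  · have h1 : Bᶜ ∩ A = ∅ := by
      ext ω
      simp only [mem_inter_iff, mem_compl_iff, mem_empty_iff_false, iff_false]
      exact fun h => h.1 (hAB h.2)
    have h2 : Bᶜ ∩ (B \ A) = ∅ := by
      ext ω
      simp only [mem_inter_iff, mem_compl_iff, mem_sdiff, mem_empty_iff_false, iff_false]
      exact fun h => h.1 h.2.1
    simp [Measure.restrict_apply hB.compl, h1, h2]
  · intro C hC
    have h2 : C ∩ (B \ A) = ∅ := by
      ext ω
      simp only [mem_inter_iff, mem_sdiff, mem_empty_iff_false, iff_false]
      exact fun h => h.2.2 (hC h.1)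
    simp [Measure.restrict_apply' hA, Measure.restrict_apply' (hB.diff hA), h2,
      inter_eq_left.2 hC]

/-- The upper tail of mass `s` of a bounded random variable. -/
lemma exists_tail_measure [IsProbabilityMeasure P] {Z : Ω → ℝ} (hZ : Measurable Z) {M : ℝ}
    (hM : ∀ ω, |Z ω| ≤ M) {s : ℝ} (hs : s ∈ Icc (0:ℝ) 1) :
    ∃ Q : Measure Ω, Q ≤ P ∧ Q.real univ = s ∧
      ∀ x, min (P.real {ω | Z ω > x}) s ≤ Q.real {ω | Z ω > x} := by
  obtain ⟨a, -, h1, h2⟩ := exists_quantile (P := P) hZ hM hs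
  obtain ⟨Q, hQP, hQs, hQB, hQA⟩ := exists_measure_between (P := P)
    (measurableSet_lt measurable_const hZ : MeasurableSet {ω | Z ω > a})
    (measurableSet_le measurable_const hZ : MeasurableSet {ω | a ≤ Z ω})
    (fun ω (hω : a < Z ω) => hω.le) h1 h2
  have : IsFiniteMeasure Q := isFiniteMeasure_of_le P hQP
  refine ⟨Q, hQP, hQs, fun x => ?_⟩
  rcases le_or_gt a x with hax | hax
  · refine (min_le_left _ _).trans_eq ?_
    rw [Measure.real, Measure.real, hQA {ω | Z ω > x} fun ω (hω : x < Z ω) => hax.trans_lt hω]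
  · refine (min_le_right _ _).trans ?_
    have hsub : {ω | Z ω > x}ᶜ ⊆ {ω | a ≤ Z ω}ᶜ := fun ω hω h => hω (hax.trans_le h)
    have h0 : Q.real {ω | Z ω > x}ᶜ = 0 := by
      rw [Measure.real, measure_mono_null hsub hQB, ENNReal.toReal_zero]
    have := measureReal_add_measureReal_compl (μ := Q)
      (measurableSet_lt measurable_const hZ : MeasurableSet {ω | Z ω > x})
    linarith

lemma Cpm_ge {p s u v : ℝ} (hs : p ≤ s) (hu : 1 - s ≤ u) (hv : 1 - s ≤ v) :
    1 - s ≤ Cpm p u v := by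
  rw [Cpm]
  split_ifs
  · exact le_min hu hv
  · exact le_max_of_le_right (by linarith)

lemma measureReal_le_eq [IsProbabilityMeasure P] {X : Ω → ℝ} (hX : Measurable X) (x : ℝ) :
    P.real {ω | X ω ≤ x} = 1 - P.real {ω | X ω > x} := by
  have h := probReal_compl_eq_one_sub (μ := P)
    (measurableSet_lt measurable_const hX : MeasurableSet {ω | X ω > x})
  rw [← h]
  congr 1
  ext ω
  simp

lemma measureReal_or_gt [IsProbabilityMeasure P] {X Y : Ω → ℝ} (hX : Measurable X)
    (hY : Measurable Y) {C : ℝ → ℝ → ℝ} (hC : HasCopula P X Y C) (x y : ℝ) :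
    P.real {ω | X ω > x ∨ Y ω > y} =
      1 - C (P.real {ω | X ω ≤ x}) (P.real {ω | Y ω ≤ y}) := by
  have h := hC x y
  have hmeas : MeasurableSet {ω | X ω ≤ x ∧ Y ω ≤ y} :=
    (measurableSet_le hX measurable_const).inter (measurableSet_le hY measurable_const)
  have h' := probReal_compl_eq_one_sub (μ := P) hmeas
  simp only [← measureReal_def] at h
  rw [← h, ← h']
  congr 1
  ext ω
  simp only [mem_ofPred_eq, mem_compl_iff, not_and_or, not_le]

/-- Under `Cpm p`, the event that `X` exceeds its `s`-quantile while `Y` is below its own is null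
for `p ≤ s`. -/
lemma measure_gt_and_lt_eq_zero [IsProbabilityMeasure P] {X Y : Ω → ℝ} {p s a b : ℝ}
    (hX : Measurable X) (hY : Measurable Y) (hC : HasCopula P X Y (Cpm p)) (hs : p ≤ s)
    (ha : P.real {ω | X ω > a} ≤ s) (hb : ∀ y < b, s ≤ P.real {ω | Y ω > y}) :
    P {ω | X ω > a ∧ Y ω < b} = 0 := by
  obtain ⟨u, -, hua, hlim⟩ := exists_seq_strictMono_tendsto b
  have hsub : {ω | X ω > a ∧ Y ω < b} ⊆ ⋃ n, {ω | X ω > a ∧ Y ω ≤ u n} := fun ω hω =>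
    mem_iUnion.2 <| by
      obtain ⟨n, hn⟩ := (hlim.eventually_const_lt hω.2).exists
      exact ⟨n, hω.1, hn.le⟩
  refine measure_mono_null hsub (measure_iUnion_null fun n => ?_)
  have h1 := hC a (u n)
  simp only [← measureReal_def] at h1
  have hY' := measureReal_le_eq (P := P) hY (u n)
  have hX' := measureReal_le_eq (P := P) hX a
  have hb' := hb _ (hua n)
  have hmin : min (P.real {ω | X ω ≤ a}) (P.real {ω | Y ω ≤ u n}) = P.real {ω | Y ω ≤ u n} :=
    min_eq_right (by linarith)
  rw [Cpm, hmin, if_pos (by linarith)] at h1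
  have h2 := measureReal_inter_add_sdiff (μ := P) (s := {ω | Y ω ≤ u n})
    (measurableSet_le hX measurable_const : MeasurableSet {ω | X ω ≤ a})
  rw [← measureReal_eq_zero_iff]
  have e1 : {ω | Y ω ≤ u n} ∩ {ω | X ω ≤ a} = {ω | X ω ≤ a ∧ Y ω ≤ u n} := by
    ext; simp [and_comm]
  have e2 : {ω | Y ω ≤ u n} \ {ω | X ω ≤ a} = {ω | X ω > a ∧ Y ω ≤ u n} := by
    ext; simp [and_comm]
  rw [e1, e2] at h2
  linarith

lemma Cpm_comm (p u v : ℝ) : Cpm p u v = Cpm p v u := by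
  simp only [Cpm, min_comm u v, add_comm u v]

lemma HasCopula.swap_Cpm {X Y : Ω → ℝ} {p : ℝ} (hC : HasCopula P X Y (Cpm p)) :
    HasCopula P Y X (Cpm p) := fun x y => by
  rw [Cpm_comm, ← hC y x]
  simp only [and_comm]

/-- Under `Cpm p`, the upper tails of mass `s ≥ p` of the two components coincide. -/
lemma exists_common_tail_measure [IsProbabilityMeasure P] {X Y : Ω → ℝ} {p s M : ℝ}
    (hX : Measurable X) (hY : Measurable Y) (hXM : ∀ ω, |X ω| ≤ M) (hYM : ∀ ω, |Y ω| ≤ M)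
    (hC : HasCopula P X Y (Cpm p)) (hps : p ≤ s) (hs : s ∈ Icc (0:ℝ) 1) :
    ∃ Q : Measure Ω, Q ≤ P ∧ Q.real univ = s ∧
      ∀ x y, min (P.real {ω | X ω > x ∨ Y ω > y}) s ≤ Q.real {ω | X ω > x ∨ Y ω > y} := by
  obtain ⟨a, ha, ha1, -⟩ := exists_quantile (P := P) hX hXM hs
  obtain ⟨b, hb, hb1, -⟩ := exists_quantile (P := P) hY hYM hs
  have hmeas : ∀ x y, MeasurableSet {ω | X ω > x ∨ Y ω > y} := fun x y =>
    (measurableSet_lt measurable_const hX).union (measurableSet_lt measurable_const hY)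
  let A : Set Ω := {ω | X ω > a ∨ Y ω > b}
  let B : Set Ω := {ω | a ≤ X ω ∧ b ≤ Y ω}
  have hA : MeasurableSet A := hmeas a b
  have hB : MeasurableSet B :=
    (measurableSet_le measurable_const hX).inter (measurableSet_le measurable_const hY)
  have hnull : P (A \ B) = 0 := by
    refine measure_mono_null (t := {ω | X ω > a ∧ Y ω < b} ∪ {ω | Y ω > b ∧ X ω < a}) ?_
      (measure_union_null (measure_gt_and_lt_eq_zero hX hY hC hps ha1 hb)
        (measure_gt_and_lt_eq_zero hY hX hC.swap_Cpm hps hb1 ha))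
    rintro ω ⟨hω, hω'⟩
    simp only [A, B, mem_ofPred_eq, not_and_or, not_le, mem_union] at *
    grind
  have hsA : P.real (A ∩ B) ≤ s := by
    refine (measureReal_mono inter_subset_left).trans ?_
    have := Cpm_ge (u := P.real {ω | X ω ≤ a}) (v := P.real {ω | Y ω ≤ b}) hps
      (by rw [measureReal_le_eq hX]; linarith) (by rw [measureReal_le_eq hY]; linarith)
    rw [measureReal_or_gt hX hY hC]
    linarith
  have hsB : s ≤ P.real B := by
    have h := le_measureReal_ge_of_forall_lt (P := P) (V := fun ω => min (X ω - a) (Y ω - b))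
      ((hX.sub_const a).min (hY.sub_const b)) (a := 0) (s := s) fun x hx => by
        have hax := ha (a + x) (by linarith)
        have hbx := hb (b + x) (by linarith)
        have h1 := measureReal_or_gt hX hY hC (a + x) (b + x)
        rw [Cpm, measureReal_le_eq hX, measureReal_le_eq hY,
          if_pos (min_le_of_left_le (by linarith))] at h1
        have h2 := measureReal_union_add_inter (μ := P) (s := {ω | X ω > a + x})
          (measurableSet_lt measurable_const hY : MeasurableSet {ω | Y ω > b + x})
        have e1 : {ω | X ω > a + x} ∪ {ω | Y ω > b + x} =
            {ω | X ω > a + x ∨ Y ω > b + x} := rfl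
        have e2 : {ω | X ω > a + x} ∩ {ω | Y ω > b + x} =
            {ω | min (X ω - a) (Y ω - b) > x} := by
          ext ω
          simp only [mem_inter_iff, mem_ofPred_eq, gt_iff_lt, lt_min_iff, lt_sub_iff_add_lt']
        rw [e1, e2, h1] at h2
        rcases min_choice (1 - P.real {ω | X ω > a + x}) (1 - P.real {ω | Y ω > b + x}) with h | h
          <;> rw [h] at h2 <;> linarith
    refine h.trans_eq (congrArg P.real ?_)
    ext ω
    simp [B]
  obtain ⟨Q, hQP, hQs, hQB, hQA⟩ :=
    exists_measure_between (P := P) (hA.inter hB) hB inter_subset_right hsA hsB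
  have : IsFiniteMeasure Q := isFiniteMeasure_of_le P hQP
  refine ⟨Q, hQP, hQs, fun x y => ?_⟩
  by_cases hxy : a ≤ x ∧ b ≤ y
  · refine (min_le_left _ _).trans ?_
    have hsub : {ω | X ω > x ∨ Y ω > y} ⊆ A := fun ω hω =>
      hω.imp (fun h => lt_of_le_of_lt hxy.1 h) (fun h => lt_of_le_of_lt hxy.2 h)
    have h1 := measureReal_inter_add_sdiff (μ := P) (s := {ω | X ω > x ∨ Y ω > y}) hB
    have h2 : P.real ({ω | X ω > x ∨ Y ω > y} \ B) = 0 := by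
      rw [Measure.real, measure_mono_null (sdiff_subset_sdiff_left hsub) hnull,
        ENNReal.toReal_zero]
    have h3 : Q.real ({ω | X ω > x ∨ Y ω > y} ∩ B) = P.real ({ω | X ω > x ∨ Y ω > y} ∩ B) := by
      rw [Measure.real, Measure.real, hQA _ (inter_subset_inter_left B hsub)]
    have h4 : Q.real ({ω | X ω > x ∨ Y ω > y} ∩ B) ≤ Q.real {ω | X ω > x ∨ Y ω > y} :=
      measureReal_mono inter_subset_left
    linarith
  · refine (min_le_right _ _).trans ?_
    have hsub : {ω | X ω > x ∨ Y ω > y}ᶜ ⊆ Bᶜ := fun ω hω h => by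
      simp only [mem_compl_iff, mem_ofPred_eq, not_or, not_lt, B] at hω h
      exact hxy ⟨h.1.trans hω.1, h.2.trans hω.2⟩
    have h0 : Q.real {ω | X ω > x ∨ Y ω > y}ᶜ = 0 := by
      rw [Measure.real, measure_mono_null hsub hQB, ENNReal.toReal_zero]
    have := measureReal_add_measureReal_compl (μ := Q) (hmeas x y)
    linarith

end Tail

section Layers

variable {Q : Measure Ω} [IsFiniteMeasure Q]

lemma intervalIntegrable_measureReal_section {E : Set (Ω × ℝ)} (hE : MeasurableSet E) (a b : ℝ) :
    IntervalIntegrable (fun t => Q.real {ω | (ω, t) ∈ E}) volume a b := by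
  refine intervalIntegrable_const (c := Q.real univ) |>.mono_fun ?_ ?_
  · exact (measurable_measure_prodMk_right hE).ennreal_toReal.aestronglyMeasurable
  · refine Filter.Eventually.of_forall fun t => ?_
    show ‖Q.real {ω | (ω, t) ∈ E}‖ ≤ ‖Q.real univ‖
    rw [Real.norm_of_nonneg measureReal_nonneg, Real.norm_of_nonneg measureReal_nonneg]
    exact measureReal_mono (subset_univ _)

lemma integral_measureReal_section {E : Set (Ω × ℝ)} (hE : MeasurableSet E) {a b : ℝ}
    (hab : a ≤ b) : ∫ t in a..b, Q.real {ω | (ω, t) ∈ E} =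
      ∫ ω, volume.real ({t | (ω, t) ∈ E} ∩ Ioc a b) ∂Q := by
  have h1 : ∫ t in a..b, Q.real {ω | (ω, t) ∈ E} =
      (Q.prod (volume.restrict (Ioc a b))).real E := by
    rw [intervalIntegral.integral_of_le hab, Measure.real, Measure.prod_apply_symm hE]
    exact integral_toReal (measurable_measure_prodMk_right hE).aemeasurable
      (Filter.Eventually.of_forall fun t => measure_lt_top Q _)
  have h2 : ∫ ω, volume.real ({t | (ω, t) ∈ E} ∩ Ioc a b) ∂Q =
      (Q.prod (volume.restrict (Ioc a b))).real E := by
    rw [Measure.real, Measure.prod_apply hE,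
      ← integral_toReal (measurable_measure_prodMk_left hE).aemeasurable
        (Filter.Eventually.of_forall fun ω => measure_lt_top _ _)]
    refine integral_congr_ae (Filter.Eventually.of_forall fun ω => ?_)
    simp only [Measure.real]
    rw [Measure.restrict_apply' measurableSet_Ioc]
    rfl
  rw [h1, h2]

variable {X Y : Ω → ℝ}

lemma measurableSet_add_gt (hX : Measurable X) (hY : Measurable Y) :
    MeasurableSet {q : Ω × ℝ | X q.1 + Y q.1 > q.2} :=
  measurableSet_lt measurable_snd
    ((hX.comp measurable_fst).add (hY.comp measurable_fst))

lemma measurableSet_or_gt (hX : Measurable X) (hY : Measurable Y) (y : ℝ) :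
    MeasurableSet {q : Ω × ℝ | X q.1 > q.2 ∨ Y q.1 > y - q.2} :=
  (measurableSet_lt measurable_snd (hX.comp measurable_fst)).union
    (measurableSet_lt (measurable_const.sub measurable_snd) (hY.comp measurable_fst))

lemma volume_add_gt_eq {M u v y : ℝ} (hM : 0 < M) (hu : |u| ≤ M) (hv : |v| ≤ M)
    (hy : y ∈ Icc (-(2 * M)) (2 * M)) :
    volume.real ({t | u + v > t} ∩ Ioc (-(2 * M)) y) =
      volume.real ({t | u > t ∨ v > y - t} ∩ Ioc (-(3 * M)) (3 * M)) + (y - 4 * M) := by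
  rw [abs_le] at hu hv
  obtain ⟨hy1, hy2⟩ := hy
  rcases lt_or_ge y (u + v) with h | h
  · have e1 : {t | u + v > t} ∩ Ioc (-(2 * M)) y = Ioc (-(2 * M)) y :=
      inter_eq_right.2 fun t ht => ht.2.trans_lt h
    have e2 : {t | u > t ∨ v > y - t} ∩ Ioc (-(3 * M)) (3 * M) = Ioc (-(3 * M)) (3 * M) :=
      inter_eq_right.2 fun t ht => by
        simp only [mem_ofPred_eq]
        by_contra! hc
        linarith [hc.1, hc.2]
    rw [e1, e2, Real.volume_real_Ioc_of_le hy1, Real.volume_real_Ioc_of_le (by linarith)]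
    ring
  · have e1 : {t | u + v > t} ∩ Ioc (-(2 * M)) y = Ioo (-(2 * M)) (u + v) := by
      ext t
      simp only [mem_inter_iff, mem_ofPred_eq, mem_Ioc, mem_Ioo]
      exact ⟨fun ht => ⟨ht.2.1, ht.1⟩, fun ht => ⟨ht.2, ht.1, ht.2.le.trans h⟩⟩
    have e2 : {t | u > t ∨ v > y - t} ∩ Ioc (-(3 * M)) (3 * M) =
        Ioc (-(3 * M)) (3 * M) \ Icc u (y - v) := by
      ext t
      simp only [mem_inter_iff, mem_ofPred_eq, mem_sdiff, mem_Icc, not_and_or, not_le]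
      rw [and_comm, gt_iff_lt, gt_iff_lt, sub_lt_comm]
    have hsub : volume.real (Ioc (-(3 * M)) (3 * M) \ Icc u (y - v)) =
        6 * M - (y - v - u) := by
      have hIcc : Icc u (y - v) ⊆ Ioc (-(3 * M)) (3 * M) :=
        fun t ht => ⟨by linarith [ht.1], by linarith [ht.2]⟩
      rw [measureReal_sdiff hIcc measurableSet_Icc (by simp),
        Real.volume_real_Ioc_of_le (by linarith), Real.volume_real_Icc_of_le (by linarith)]
      ring
    rw [e1, e2, hsub, Real.volume_real_Ioo_of_le (by linarith)]
    ring

/-- A layer-cake identity for `E[min (X + Y, y)]`. -/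
lemma integral_measureReal_add_gt (hX : Measurable X) (hY : Measurable Y) {M y : ℝ}
    (hM : 0 < M) (hXM : ∀ ω, |X ω| ≤ M) (hYM : ∀ ω, |Y ω| ≤ M) (hy : y ∈ Icc (-(2 * M)) (2 * M)) :
    ∫ x in (-(2 * M))..y, Q.real {ω | X ω + Y ω > x} =
      (∫ t in (-(3 * M))..(3 * M), Q.real {ω | X ω > t ∨ Y ω > y - t}) +
        (y - 4 * M) * Q.real univ := by
  have h1 := integral_measureReal_section (Q := Q) (measurableSet_add_gt hX hY) hy.1
  have h2 := integral_measureReal_section (Q := Q) (measurableSet_or_gt hX hY y)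
    (show -(3 * M) ≤ 3 * M by linarith)
  simp only [mem_ofPred_eq] at h1 h2
  rw [h1, h2]
  simp_rw [fun ω => volume_add_gt_eq hM (hXM ω) (hYM ω) hy]
  rw [integral_add _ (integrable_const _), integral_const, smul_eq_mul, mul_comm (Q.real univ)]
  refine Integrable.mono' (integrable_const (6 * M)) ?_ ?_
  · have := (measurable_measure_prodMk_left (ν := volume.restrict (Ioc (-(3 * M)) (3 * M)))
      (measurableSet_or_gt hX hY y)).ennreal_toReal
    convert! this.aestronglyMeasurable using 2 with ω
    rw [Measure.restrict_apply' measurableSet_Ioc]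
    rfl
  · refine Filter.Eventually.of_forall fun ω => ?_
    rw [Real.norm_of_nonneg measureReal_nonneg]
    refine (measureReal_mono inter_subset_right (by simp)).trans_eq ?_
    rw [Real.volume_real_Ioc_of_le (by linarith)]
    ring

end Layers

/-- Under `Cpm p`, the sum maximizes the truncated integrals of the survival function: all of them
at level `p`, and the complete ones at every level `s ≥ p`. -/
lemma integral_min_survival_le {P : Measure Ω} [IsProbabilityMeasure P] {X Y X' Y' : Ω → ℝ}
    {p s M y : ℝ} (hX : Measurable X) (hY : Measurable Y) (hX' : Measurable X')
    (hY' : Measurable Y') (hM : 0 < M) (hXM : ∀ ω, |X ω| ≤ M) (hYM : ∀ ω, |Y ω| ≤ M)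
    (hXM' : ∀ ω, |X' ω| ≤ M) (hYM' : ∀ ω, |Y' ω| ≤ M) (hC : HasCopula P X Y (Cpm p))
    (hXX' : IdentDistrib X X' P P) (hYY' : IdentDistrib Y Y' P P) (hps : p ≤ s)
    (hs : s ∈ Icc (0:ℝ) 1) (hy : y ∈ Icc (-(2 * M)) (2 * M)) (hsy : s = p ∨ y = 2 * M) :
    ∫ x in (-(2 * M))..y, min (P.real {ω | X' ω + Y' ω > x}) s ≤
      ∫ x in (-(2 * M))..y, min (P.real {ω | X ω + Y ω > x}) s := by
  have hZM' : ∀ ω, |X' ω + Y' ω| ≤ 2 * M := fun ω =>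
    (abs_add_le _ _).trans (by linarith [hXM' ω, hYM' ω])
  obtain ⟨Q', hQP', hQs', hQ'⟩ := exists_tail_measure (P := P) (hX'.add hY') hZM' hs
  obtain ⟨Q, hQP, hQs, hQ⟩ := exists_common_tail_measure hX hY hXM hYM hC hps hs
  have : IsFiniteMeasure Q' := isFiniteMeasure_of_le P hQP'
  have : IsFiniteMeasure Q := isFiniteMeasure_of_le P hQP
  have hmono : ∀ {R : Measure Ω}, R ≤ P → ∀ A, R.real A ≤ P.real A := fun hR A =>
    ENNReal.toReal_mono (measure_ne_top P A) (hR A)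
  have hkey : ∀ t, Q'.real {ω | X' ω > t ∨ Y' ω > y - t} ≤
      Q.real {ω | X ω > t ∨ Y ω > y - t} := fun t => by
    refine le_trans ?_ (hQ t (y - t))
    have h1 : Q'.real {ω | X' ω > t ∨ Y' ω > y - t} ≤ s :=
      (measureReal_mono (subset_univ _)).trans_eq hQs'
    have h2 : Q'.real {ω | X' ω > t ∨ Y' ω > y - t} ≤
        P.real {ω | X ω > t} + P.real {ω | Y ω > y - t} := by
      refine (hmono hQP' _).trans
        ((measureReal_union_le {ω | X' ω > t} {ω | Y' ω > y - t}).trans_eq ?_)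
      rw [Measure.real, Measure.real, Measure.real, Measure.real]
      congr 2
      · exact (hXX'.measure_mem_eq measurableSet_Ioi).symm
      · exact (hYY'.measure_mem_eq measurableSet_Ioi).symm
    refine le_min ?_ h1
    rcases hsy with rfl | rfl
    · have h3 := measureReal_or_gt hX hY hC t (y - t)
      rw [Cpm, measureReal_le_eq hX, measureReal_le_eq hY] at h3
      split_ifs at h3 with hif
      · linarith [min_le_left (1 - P.real {ω | X ω > t}) (1 - P.real {ω | Y ω > y - t})]
      · rw [h3]
        rcases max_choice (1 - P.real {ω | X ω > t} + (1 - P.real {ω | Y ω > y - t}) - 1) (1 - s)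
          with h | h <;> rw [h] <;> linarith
    · have h3 := measureReal_union (μ := P) (s₁ := {ω | X ω > t}) (s₂ := {ω | Y ω > 2 * M - t})
        (Set.disjoint_left.2 fun ω h1 h2 => by
          simp only [mem_ofPred_eq] at h1 h2
          linarith [(abs_le.1 (hXM ω)).2, (abs_le.1 (hYM ω)).2])
        (measurableSet_lt measurable_const hY)
      exact h2.trans_eq h3.symm
  calc ∫ x in (-(2 * M))..y, min (P.real {ω | X' ω + Y' ω > x}) s
      ≤ ∫ x in (-(2 * M))..y, Q'.real {ω | X' ω + Y' ω > x} :=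
        intervalIntegral.integral_mono_on hy.1
          (intervalIntegrable_min_const (antitone_measureReal_gt P _) _ _ _)
          (antitone_measureReal_gt Q' _).intervalIntegrable fun x _ => hQ' x
    _ ≤ ∫ x in (-(2 * M))..y, Q.real {ω | X ω + Y ω > x} := by
        rw [integral_measureReal_add_gt hX' hY' hM hXM' hYM' hy,
          integral_measureReal_add_gt hX hY hM hXM hYM hy, hQs, hQs']
        gcongr
        exact intervalIntegral.integral_mono_on (by linarith)
          (intervalIntegrable_measureReal_section (measurableSet_or_gt hX' hY' y) _ _)
          (intervalIntegrable_measureReal_section (measurableSet_or_gt hX hY y) _ _)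
          fun t _ => hkey t
    _ ≤ ∫ x in (-(2 * M))..y, min (P.real {ω | X ω + Y ω > x}) s :=
        intervalIntegral.integral_mono_on hy.1
          (antitone_measureReal_gt Q _).intervalIntegrable
          (intervalIntegrable_min_const (antitone_measureReal_gt P _) _ _ _) fun x _ =>
          le_min (hmono hQP _) ((measureReal_mono (subset_univ _)).trans_eq hQs)

/-- The distorted expectation of a bounded variable as one integral over a bounded interval. -/
lemma distExp_eq_integral {P : Measure Ω} [IsProbabilityMeasure P] {h : ℝ → ℝ}
    (hdist : IsDistortion h) {Z : Ω → ℝ} {L : ℝ} (hL : 0 ≤ L) (hZ : ∀ ω, |Z ω| < L) :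
    distExp P h Z = (∫ x in (-L)..L, h (P.real {ω | Z ω > x})) - L := by
  obtain ⟨hmono, h0, h1⟩ := hdist
  have hanti : Antitone fun x => h (P.real {ω | Z ω > x}) := fun x y hxy =>
    hmono ⟨measureReal_nonneg, measureReal_le_one⟩ ⟨measureReal_nonneg, measureReal_le_one⟩
      (antitone_measureReal_gt P Z hxy)
  have hpos : ∫ x in Ioi (0:ℝ), h (P.real {ω | Z ω > x}) =
      ∫ x in (0:ℝ)..L, h (P.real {ω | Z ω > x}) := by
    rw [intervalIntegral.integral_of_le hL]
    refine (setIntegral_eq_of_subset_of_forall_sdiff_eq_zero measurableSet_Ioi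
      (fun x hx => hx.1) fun x hx => ?_)
    have hx : L < x := by
      by_contra! hc
      exact hx.2 ⟨hx.1, hc⟩
    have : {ω | Z ω > x} = ∅ := eq_empty_of_forall_notMem fun ω hω =>
      absurd ((hx.trans hω).trans (abs_lt.1 (hZ ω)).2) (lt_irrefl _)
    simp [this, h0]
  have hneg : ∫ x in Iio (0:ℝ), (h (P.real {ω | Z ω > x}) - 1) =
      ∫ x in (-L)..0, (h (P.real {ω | Z ω > x}) - 1) := by
    rw [intervalIntegral.integral_of_le (by linarith), ← integral_Iic_eq_integral_Iio]
    refine (setIntegral_eq_of_subset_of_forall_sdiff_eq_zero measurableSet_Iic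
      (fun x hx => hx.2) fun x hx => ?_)
    have hx : x ≤ -L := by
      by_contra! hc
      exact hx.2 ⟨hc, hx.1⟩
    have : {ω | Z ω > x} = univ := eq_univ_of_forall fun ω =>
      hx.trans_lt (abs_lt.1 (hZ ω)).1
    simp [this, h1]
  simp only [distExp, ← measureReal_def]
  rw [hpos, hneg, intervalIntegral.integral_sub hanti.intervalIntegrable (by simp),
    intervalIntegral.integral_const,
    ← intervalIntegral.integral_add_adjacent_intervals (μ := volume)
      (hanti.intervalIntegrable (a := -L) (b := 0)) (hanti.intervalIntegrable (a := 0) (b := L))]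
  simp only [smul_eq_mul]
  ring

lemma IsBddRV.exists_common_bound {X Y X' Y' : Ω → ℝ} (hX : IsBddRV X) (hY : IsBddRV Y)
    (hX' : IsBddRV X') (hY' : IsBddRV Y') : ∃ M : ℝ, 0 < M ∧ (∀ ω, |X ω| < M) ∧
      (∀ ω, |Y ω| < M) ∧ (∀ ω, |X' ω| < M) ∧ ∀ ω, |Y' ω| < M := by
  obtain ⟨-, a, ha⟩ := hX
  obtain ⟨-, b, hb⟩ := hY
  obtain ⟨-, c, hc⟩ := hX'
  obtain ⟨-, d, hd⟩ := hY'
  refine ⟨|a| + |b| + |c| + |d| + 1, by positivity, fun ω => ?_, fun ω => ?_, fun ω => ?_,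
    fun ω => ?_⟩
  · linarith [ha ω, le_abs_self a, abs_nonneg b, abs_nonneg c, abs_nonneg d]
  · linarith [hb ω, le_abs_self b, abs_nonneg a, abs_nonneg c, abs_nonneg d]
  · linarith [hc ω, le_abs_self c, abs_nonneg a, abs_nonneg b, abs_nonneg d]
  · linarith [hd ω, le_abs_self d, abs_nonneg a, abs_nonneg b, abs_nonneg c]

/-- If the integrals of `min f p` over initial segments are dominated by those of `min g p`, then
so are the integrals of `min f p - min f s` for `s ≤ p`. -/
lemma integral_min_sub_min_le {f g : ℝ → ℝ} (hf : Antitone f) (hg : Antitone g) {B p s : ℝ}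
    (hB : 0 ≤ B) (hsp : s ≤ p) (hlo : ∀ x < -B, s ≤ f x) (hhi : ∀ x > B, f x ≤ s)
    (hfg : ∀ y ∈ Icc (-B) B, ∫ x in (-B)..y, min (f x) p ≤ ∫ x in (-B)..y, min (g x) p) :
    (∫ x in (-B)..B, min (f x) p) - (∫ x in (-B)..B, min (f x) s) ≤
      (∫ x in (-B)..B, min (g x) p) - ∫ x in (-B)..B, min (g x) s := by
  obtain ⟨y, hy, hy1, hy2⟩ := hf.exists_level hB hlo hhi
  have hint : ∀ {k : ℝ → ℝ}, Antitone k → ∀ a b, IntervalIntegrable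
      (fun x => min (k x) p - min (k x) s) volume a b := fun hk a b =>
    (intervalIntegrable_min_const hk p a b).sub (intervalIntegrable_min_const hk s a b)
  have hp : ∀ {k : ℝ → ℝ}, Antitone k → ∀ a b, IntervalIntegrable
      (fun x => min (k x) p - s) volume a b := fun hk a b =>
    (intervalIntegrable_min_const hk p a b).sub intervalIntegrable_const
  rw [← intervalIntegral.integral_sub (intervalIntegrable_min_const hf _ _ _)
      (intervalIntegrable_min_const hf _ _ _),
    ← intervalIntegral.integral_sub (intervalIntegrable_min_const hg _ _ _)
      (intervalIntegrable_min_const hg _ _ _),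
    ← intervalIntegral.integral_add_adjacent_intervals (hint hf (-B) y) (hint hf y B),
    ← intervalIntegral.integral_add_adjacent_intervals (hint hg (-B) y) (hint hg y B)]
  have hfl : ∫ x in (-B)..y, (min (f x) p - min (f x) s) ≤ ∫ x in (-B)..y, (min (f x) p - s) := by
    refine intervalIntegral.integral_mono_on_of_le_Ioo hy.1 (hint hf _ _) (hp hf _ _)
      fun x hx => ?_
    rw [min_eq_right (hy1 x hx.2)]
  have hfr : ∫ x in y..B, (min (f x) p - min (f x) s) ≤ ∫ x in y..B, (0 : ℝ) := by
    refine intervalIntegral.integral_mono_on_of_le_Ioo hy.2 (hint hf _ _)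
      intervalIntegrable_const fun x hx => ?_
    rw [min_eq_left (hy2 x hx.1), min_eq_left ((hy2 x hx.1).trans hsp), sub_self]
  have hgl : ∫ x in (-B)..y, (min (g x) p - s) ≤ ∫ x in (-B)..y, (min (g x) p - min (g x) s) :=
    intervalIntegral.integral_mono_on hy.1 (hp hg _ _) (hint hg _ _) fun x _ =>
      sub_le_sub_left (min_le_right _ _) _
  have hgr : ∫ x in y..B, (0 : ℝ) ≤ ∫ x in y..B, (min (g x) p - min (g x) s) :=
    intervalIntegral.integral_mono_on hy.2 intervalIntegrable_const (hint hg _ _) fun x _ =>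
      sub_nonneg.2 (min_le_min_left _ hsp)
  rw [intervalIntegral.integral_sub (intervalIntegrable_min_const hf _ _ _)
    intervalIntegrable_const] at hfl
  rw [intervalIntegral.integral_sub (intervalIntegrable_min_const hg _ _ _)
    intervalIntegrable_const] at hgl
  linarith [hfg y hy]

/-- Sufficiency in the S-shaped characterization: if h is S-shaped with
inflection point p and the right derivatives satisfy h'(p⁺) ≤ h'(0⁺), then C^±_p is
universally maximal for h with linear cost. -/
theorem Cpm_univMaximal_of_SS_deriv_condition
    (P : Measure Ω) [IsProbabilityMeasure P] (hP : AtomlessProb P)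
    (h : ℝ → ℝ) (hdist : IsDistortion h)
    (p : ℝ) (hp : p ∈ Ioo (0:ℝ) 1) (hss : IsSS h p)
    (d0 dp : ℝ) (hd0 : HasDerivWithinAt h d0 (Ioi 0) 0)
    (hdp : HasDerivWithinAt h dp (Ioi p) p) (hcond : dp ≤ d0) :
    UnivMaximal P h (Cpm p) := by
  intro X Y X' Y' hX hY hX' hY' hC hXX' hYY'
  obtain ⟨M, hM, hXM, hYM, hXM', hYM'⟩ := hX.exists_common_bound hY hX' hY'
  have hZM : ∀ ω, |X ω + Y ω| < 2 * M := fun ω =>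
    (abs_add_le _ _).trans_lt (by linarith [hXM ω, hYM ω])
  have hZM' : ∀ ω, |X' ω + Y' ω| < 2 * M := fun ω =>
    (abs_add_le _ _).trans_lt (by linarith [hXM' ω, hYM' ω])
  have h01 : ∀ (Z : Ω → ℝ) x, P.real {ω | Z ω > x} ∈ Icc (0:ℝ) 1 := fun Z x =>
    ⟨measureReal_nonneg, measureReal_le_one⟩
  have hkey : ∀ s y, p ≤ s → s ≤ 1 → y ∈ Icc (-(2 * M)) (2 * M) → s = p ∨ y = 2 * M →
      ∫ x in (-(2 * M))..y, min (P.real {ω | X' ω + Y' ω > x}) s ≤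
        ∫ x in (-(2 * M))..y, min (P.real {ω | X ω + Y ω > x}) s := fun s y hps hs1 hy hsy =>
    integral_min_survival_le hX.1 hY.1 hX'.1 hY'.1 hM (fun ω => (hXM ω).le) (fun ω => (hYM ω).le)
      (fun ω => (hXM' ω).le) (fun ω => (hYM' ω).le) hC hXX' hYY' hps
      ⟨hp.1.le.trans hps, hs1⟩ hy hsy
  rw [distExp_eq_integral hdist (by linarith) hZM, distExp_eq_integral hdist (by linarith) hZM']
  gcongr
  refine IsSS.integral_comp_le hdist hp hss hd0 hdp hcond (antitone_measureReal_gt P _)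
    (antitone_measureReal_gt P _) (h01 _) (h01 _) (by linarith) (fun s hs => ?_)
    fun s hs => hkey s _ hs.1 hs.2 ⟨by linarith, le_rfl⟩ (Or.inr rfl)
  have hlow := integral_min_sub_min_le (antitone_measureReal_gt P fun ω => X' ω + Y' ω)
    (antitone_measureReal_gt P fun ω => X ω + Y ω) (B := 2 * M) (by linarith) hs.2
    (fun x hx => by
      have : {ω | X' ω + Y' ω > x} = univ := eq_univ_of_forall fun ω =>
        hx.trans (abs_lt.1 (hZM' ω)).1
      simp [this, hs.2.trans hp.2.le])
    (fun x hx => by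
      have : {ω | X' ω + Y' ω > x} = ∅ := eq_empty_of_forall_notMem fun ω hω =>
        absurd ((lt_trans hx hω).trans (abs_lt.1 (hZM' ω)).2) (lt_irrefl _)
      simp [this, hs.1])
    fun y hy => hkey p y le_rfl hp.2.le hy (Or.inl rfl)
  linarith
end
end
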